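/- Let G and H be finite metacyclic groups. If ℚG and ℚH are isomorphic as ℚ-algebras, then ε^G = ε^H. -/

import Mathlib

open scoped Classical

noncomputable section

namespace ArXiv230800432

/-- The `σ`-part of a natural number: product of `p ^ vₚ(n)` over primes `p ∈ σ` dividing `n`. -/
def natPart (n : ℕ) (σ : Set ℕ) : ℕ :=
  ∏ p ∈ n.primeFactors, if p ∈ σ then p ^ (n.factorization p) else 1

/-- A metacyclic factorization `G = A·B` with `A` cyclic normal and `B` cyclic. -/
structure MetacyclicFact (G : Type*) [Group G] where
  A : Subgroup G
  B : Subgroup G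
  normalA : A.Normal
  cyclicA : IsCyclic A
  cyclicB : IsCyclic B
  mul_cover : ∀ g : G, ∃ x ∈ A, ∃ y ∈ B, g = x * y

/-- A group is metacyclic if it admits a metacyclic factorization. -/
def IsMetacyclic (G : Type*) [Group G] : Prop :=
  Nonempty (MetacyclicFact G)

variable {G : Type*} [Group G]

/-- `π_G`: primes `p` dividing `|G|` such that `G` has a normal Hall `p'`-subgroup. -/
def piSet (G : Type*) [Group G] : Set ℕ :=
  {p | p.Prime ∧ p ∣ Nat.card G ∧
    ∃ N : Subgroup G, N.Normal ∧ Nat.card N = ordCompl[p] (Nat.card G)}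

/-- `π'_G = π(G) \ π_G`. -/
def piSet' (G : Type*) [Group G] : Set ℕ :=
  {p | p.Prime ∧ p ∣ Nat.card G} \ piSet G

/-- The image mod `d` of `T_G(A)`: classes `[t]_d` such that some `g ∈ G` acts on `A` by
conjugation as `x ↦ x ^ t`.  For `d = |A|` this is exactly `T_G(A)`. -/
def TGmod (A : Subgroup G) (d : ℕ) : Subgroup (ZMod d)ˣ :=
  Subgroup.closure
    {u : (ZMod d)ˣ | ∃ g : G, ∃ t : ℕ, ((t : ZMod d) = (u : ZMod d)) ∧
      ∀ x ∈ A, g⁻¹ * x * g = x ^ t}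

/-- `T_G(A)` as subgroup of `(ℤ/|A|ℤ)ˣ`. -/
def TG (A : Subgroup G) : Subgroup (ZMod (Nat.card A))ˣ :=
  TGmod A (Nat.card A)

/-- The image of `T` under `Res_q : (ℤ/dℤ)ˣ → (ℤ/qℤ)ˣ` is trivial. -/
def resTriv (d q : ℕ) (T : Subgroup (ZMod d)ˣ) : Prop :=
  ∀ u ∈ T, ∀ t : ℕ, ((t : ZMod d) = (u : ZMod d)) → (t : ZMod q) = 1

/-- The image of `T` under `Res_q` is contained in `⟨-1⟩`. -/
def resInPMOne (d q : ℕ) (T : Subgroup (ZMod d)ˣ) : Prop :=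
  ∀ u ∈ T, ∀ t : ℕ, ((t : ZMod d) = (u : ZMod d)) →
    ((t : ZMod q) = 1 ∨ (t : ZMod q) = -1)

/-- The image of `T` under `Res_q` as a set of units mod `q`. -/
def resSet (d q : ℕ) (T : Subgroup (ZMod d)ˣ) : Set (ZMod q)ˣ :=
  {v | ∃ u ∈ T, ∃ t : ℕ, ((t : ZMod d) = (u : ZMod d)) ∧ ((t : ZMod q) = (v : ZMod q))}

/-- The set of natural numbers representing elements of `T ≤ (ℤ/dℤ)ˣ`. -/
def liftSet {d : ℕ} (T : Subgroup (ZMod d)ˣ) : Set ℕ :=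
  {t | ∃ u ∈ T, (t : ZMod d) = (u : ZMod d)}

/-- `r^G(A)`: the greatest divisor `r` of `|A|` such that `Res_{r_{2'}}(T_G(A)) = 1` and
`Res_{r_2}(T_G(A)) ⊆ ⟨-1⟩`. -/
def rOfA (A : Subgroup G) : ℕ :=
  sSup {r : ℕ | r ∣ Nat.card A ∧ resTriv (Nat.card A) (ordCompl[2] r) (TG A) ∧
    resInPMOne (Nat.card A) (ordProj[2] r) (TG A)}

/-- `ε^G(A)`: `-1` if `Res_{r_2}(T_G(A)) ≠ 1`, and `1` otherwise. -/
def epsOfA (A : Subgroup G) : ℤ :=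
  if resTriv (Nat.card A) (ordProj[2] (rOfA A)) (TG A) then 1 else -1

/-- `k^G(A)`: order of the image of `T_G(A)` in `(ℤ/m_ν ℤ)ˣ`, `ν` the primes dividing `|A|`
but not `r^G(A)`. -/
def kOfA (A : Subgroup G) : ℕ :=
  (resSet (Nat.card A) (natPart (Nat.card A) {p | ¬ p ∣ rOfA A}) (TG A)).ncard

/-- The triple `(|A|, r^G(A), [G:B])` attached to a metacyclic factorization. -/
def factTriple (f : MetacyclicFact G) : ℕ × ℕ × ℕ :=
  (Nat.card f.A, rOfA f.A, f.B.index)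

/-- Lexicographic order on triples. -/
def lex3 (x y : ℕ × ℕ × ℕ) : Prop :=
  x.1 < y.1 ∨ (x.1 = y.1 ∧ (x.2.1 < y.2.1 ∨ (x.2.1 = y.2.1 ∧ x.2.2 ≤ y.2.2)))

/-- A metacyclic factorization is minimal when its triple is lexicographically minimal. -/
def IsMinimalFact (f : MetacyclicFact G) : Prop :=
  ∀ f' : MetacyclicFact G, lex3 (factTriple f) (factTriple f')

def mOf (f : MetacyclicFact G) : ℕ := Nat.card f.A
def nOf (f : MetacyclicFact G) : ℕ := f.A.index
def sOf (f : MetacyclicFact G) : ℕ := f.B.index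
def rOf (f : MetacyclicFact G) : ℕ := rOfA f.A
def epsOf (f : MetacyclicFact G) : ℤ := epsOfA f.A
def kOf (f : MetacyclicFact G) : ℕ := kOfA f.A

/-- The `σ`-part of an element of a finite group. -/
def elemPart (σ : Set ℕ) (g : G) : G :=
  g ^ ((orderOf g / natPart (orderOf g) σ) *
    (((orderOf g / natPart (orderOf g) σ : ℕ) : ZMod (natPart (orderOf g) σ))⁻¹.val))

/-- The (unique, for `N` cyclic) Hall `σ`-subgroup of a subgroup `N`. -/
def hallOf (N : Subgroup G) (σ : Set ℕ) : Subgroup G :=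
  Subgroup.closure {x : G | x ∈ N ∧ orderOf x ∣ natPart (Nat.card N) σ}

/-- `R^G = T_G(G'_{π'})`, realized as a subgroup of `(ℤ/dℤ)ˣ`. -/
def ROf (G : Type*) [Group G] (d : ℕ) : Subgroup (ZMod d)ˣ :=
  TGmod (hallOf (commutator G) (piSet' G)) d

/-- `G` is presented by `x ^ m = 1`, `b ^ n = x ^ k` and `b⁻¹ x b = x ^ t`, with `⟨x⟩` normal of
order `m` and index `n`. -/
structure MetaPres (x b : G) (m n k t : ℕ) : Prop where
  ord : orderOf x = m
  mpos : 0 < m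
  npos : 0 < n
  tpos : 0 < t
  conj : b⁻¹ * x * b = x ^ t
  pow : b ^ n = x ^ k
  dvd : ∀ i : ℤ, b ^ i ∈ Subgroup.zpowers x → (n : ℤ) ∣ i
  gen : ∀ g : G, ∃ i l : ℕ, g = b ^ i * x ^ l
  card : Nat.card G = n * m

theorem MetacyclicFact.exists_metaPres [Finite G] (f : MetacyclicFact G) :
    ∃ (x b : G) (m n k t : ℕ), f.A = Subgroup.zpowers x ∧ MetaPres x b m n k t := by
  obtain ⟨x, hx⟩ := (Subgroup.isCyclic_iff_exists_zpowers_eq_top f.A).1 f.cyclicA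
  obtain ⟨b, hb⟩ := (Subgroup.isCyclic_iff_exists_zpowers_eq_top f.B).1 f.cyclicB
  have hA := f.normalA
  have hmul := f.mul_cover
  rw [← hx] at hA hmul
  rw [← hb] at hmul
  have hgen : ∀ g : G, ∃ i l : ℕ, g = b ^ i * x ^ l := by
    intro g
    obtain ⟨y, hy, z, hz, rfl⟩ := hmul g
    obtain ⟨i, rfl⟩ := (mem_powers_iff_mem_zpowers (x := b)).2 hz
    have : (b ^ i)⁻¹ * y * b ^ i ∈ Subgroup.zpowers x := by
      simpa using hA.conj_mem y hy (b ^ i)⁻¹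
    obtain ⟨l, hl⟩ := (mem_powers_iff_mem_zpowers (x := x)).2 this
    refine ⟨i, l, ?_⟩
    simp only at hl
    rw [hl]
    group
  have hconj : b⁻¹ * x * b ∈ Subgroup.zpowers x := by
    simpa using hA.conj_mem x (Subgroup.mem_zpowers x) b⁻¹
  obtain ⟨t, ht⟩ := (mem_powers_iff_mem_zpowers (x := x)).2 hconj
  have hpow : b ^ (Subgroup.zpowers x).index ∈ Subgroup.zpowers x :=
    Subgroup.pow_index_mem _ b
  obtain ⟨k, hk⟩ := (mem_powers_iff_mem_zpowers (x := x)).2 hpow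
  refine ⟨x, b, orderOf x, (Subgroup.zpowers x).index, k, t + orderOf x, hx.symm,
    rfl, orderOf_pos x, Nat.pos_of_ne_zero Subgroup.index_ne_zero_of_finite,
    Nat.add_pos_right t (orderOf_pos x), ?_, hk.symm, ?_, hgen, ?_⟩
  · rw [pow_add, pow_orderOf_eq_one, mul_one]
    exact ht.symm
  · intro i hi
    have h1 : orderOf (b : G ⧸ Subgroup.zpowers x) = (Subgroup.zpowers x).index := by
      rw [Subgroup.index]
      refine orderOf_eq_card_of_forall_mem_zpowers ?_
      intro q
      obtain ⟨g, rfl⟩ := QuotientGroup.mk_surjective q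
      obtain ⟨i, l, rfl⟩ := hgen g
      refine ⟨i, ?_⟩
      have : ((x ^ l : G) : G ⧸ Subgroup.zpowers x) = 1 := by
        rw [QuotientGroup.eq_one_iff]
        exact Subgroup.npow_mem_zpowers x l
      rw [QuotientGroup.mk_mul, this]
      simp
    rw [← h1, orderOf_dvd_iff_zpow_eq_one, ← QuotientGroup.mk_zpow, QuotientGroup.eq_one_iff]
    exact hi
  · rw [← Nat.card_zpowers x, mul_comm, Subgroup.card_mul_index]

namespace MetaPres

variable {x b : G} {m n k t : ℕ}

theorem pow_mul_pow (h : MetaPres x b m n k t) (i l : ℕ) :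
    x ^ l * b ^ i = b ^ i * x ^ (l * t ^ i) := by
  have h1 : ∀ l, x ^ l * b = b * x ^ (l * t) := by
    intro l
    have : b⁻¹ * x ^ l * b = x ^ (l * t) := by
      rw [mul_comm l t, pow_mul, ← h.conj]
      simpa using (conj_pow (i := l) (a := b⁻¹) (b := x)).symm
    rw [← this]; group
  induction i generalizing l with
  | zero => simp
  | succ i ih =>
    rw [pow_succ, ← mul_assoc, ih, mul_assoc, h1, mul_assoc, pow_succ, mul_assoc]

/-- Extension of an assignment of the generators satisfying the relations to a homomorphism. -/
theorem exists_hom (h : MetaPres x b m n k t) {M : Type*} [Group M] {X Y : M} (hX : X ^ m = 1)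
    (hY : Y ^ n = X ^ k) (hc : Y⁻¹ * X * Y = X ^ t) :
    ∃ φ : G →* M, φ x = X ∧ φ b = Y := by
  have cp : ∀ i l : ℕ, X ^ l * Y ^ i = Y ^ i * X ^ (l * t ^ i) := by
    intro i
    have h1 : ∀ l, X ^ l * Y = Y * X ^ (l * t) := by
      intro l
      have : Y⁻¹ * X ^ l * Y = X ^ (l * t) := by
        rw [mul_comm l t, pow_mul, ← hc]
        simpa using (conj_pow (i := l) (a := Y⁻¹) (b := X)).symm
      rw [← this]; group
    induction i with
    | zero => simp
    | succ i ih =>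
      intro l
      rw [pow_succ, ← mul_assoc, ih, mul_assoc, h1, mul_assoc, pow_succ, mul_assoc]
  have key : ∀ i l i' l' : ℕ, b ^ i * x ^ l = b ^ i' * x ^ l' →
      Y ^ i * X ^ l = Y ^ i' * X ^ l' := by
    intro i l i' l' e
    have e1 : b ^ ((i : ℤ) - i') = x ^ ((l' : ℤ) - l) := by
      have : b ^ i = b ^ i' * x ^ l' * (x ^ l)⁻¹ := by rw [← e]; group
      rw [sub_eq_neg_add, zpow_add, zpow_natCast, this]; group
    obtain ⟨q, hq⟩ := h.dvd _ (by rw [e1]; exact Subgroup.zpow_mem_zpowers x _)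
    have e2 : x ^ ((k : ℤ) * q) = x ^ ((l' : ℤ) - l) := by
      rw [← e1, hq, zpow_mul, zpow_mul, zpow_natCast, zpow_natCast, h.pow]
    have e3 : X ^ ((k : ℤ) * q) = X ^ ((l' : ℤ) - l) := by
      rw [zpow_eq_zpow_iff_modEq, h.ord] at e2
      rw [zpow_eq_zpow_iff_modEq]
      exact e2.of_dvd (Int.natCast_dvd_natCast.2 (orderOf_dvd_of_pow_eq_one hX))
    have e4 : Y ^ ((i : ℤ) - i') = X ^ ((l' : ℤ) - l) := by
      rw [← e3, hq, zpow_mul, zpow_mul, zpow_natCast, zpow_natCast, hY]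
    have : Y ^ (i : ℤ) = Y ^ (i' : ℤ) * X ^ ((l' : ℤ) - l) := by
      rw [← e4, ← zpow_add]; congr 1; ring
    rw [← zpow_natCast Y i, this, ← zpow_natCast Y i', ← zpow_natCast X l, ← zpow_natCast X l',
      mul_assoc, ← zpow_add]
    congr 2; ring
  choose I L hIL using h.gen
  refine ⟨MonoidHom.mk' (fun g => Y ^ I g * X ^ L g) ?_, ?_, ?_⟩
  · intro g g'
    have e : b ^ I (g * g') * x ^ L (g * g') =
        b ^ (I g + I g') * x ^ (L g * t ^ I g' + L g') := by
      rw [← hIL, pow_add, pow_add, mul_assoc, ← mul_assoc (b ^ I g'), ← h.pow_mul_pow]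
      conv_lhs => rw [hIL g, hIL g']
      group
    change _ = Y ^ I g * X ^ L g * (Y ^ I g' * X ^ L g')
    rw [key _ _ _ _ e, pow_add, pow_add, mul_assoc, ← mul_assoc (Y ^ I g'), ← cp]
    group
  · have := key (I x) (L x) 0 1 (by rw [← hIL]; simp)
    simpa using this
  · have := key (I b) (L b) 1 0 (by rw [← hIL]; simp)
    simpa using this

theorem t_coprime (h : MetaPres x b m n k t) : Nat.Coprime t m := by
  have h1 : orderOf (x ^ t) = orderOf x := by
    rw [← h.conj]
    exact (SemiconjBy.orderOf_eq b (by simp [SemiconjBy, mul_assoc] : SemiconjBy b _ x))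
  have hm := h.mpos
  have hfin : IsOfFinOrder x := by rw [← orderOf_pos_iff, h.ord]; exact hm
  rw [hfin.orderOf_pow, h.ord] at h1
  rcases (Nat.div_eq_self.1 h1) with h2 | h2
  · omega
  · rw [Nat.gcd_comm] at h2; exact h2

theorem t_pow_n (h : MetaPres x b m n k t) : t ^ n ≡ 1 [MOD m] := by
  rw [← h.ord, ← pow_eq_pow_iff_modEq]
  have := h.pow_mul_pow n 1
  rw [h.pow, ← pow_add, ← pow_add, pow_eq_pow_iff_modEq, one_mul, add_comm] at this
  rw [pow_eq_pow_iff_modEq]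
  exact (Nat.ModEq.add_left_cancel' _ this).symm

theorem k_mul (h : MetaPres x b m n k t) : k * t ≡ k [MOD m] := by
  rw [← h.ord, ← pow_eq_pow_iff_modEq]
  have := h.pow_mul_pow 1 k
  rw [pow_one, pow_one, ← h.pow, ← pow_succ, pow_succ'] at this
  rw [← h.pow]
  exact (mul_left_cancel this).symm

end MetaPres

/-- Roots of unity in the `N`-th cyclotomic field have order dividing `N` when `N` is even. -/
theorem pow_eq_one_of_mem_adjoin {N : ℕ} (hN : 0 < N) (hev : Even N) {ζ : ℂ}
    (hζ : IsPrimitiveRoot ζ N) {u : ℂ} (hu : u ∈ IntermediateField.adjoin ℚ {ζ}) {r : ℕ}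
    (hr : 0 < r) (hur : u ^ r = 1) : u ^ N = 1 := by
  have : NeZero N := ⟨hN.ne'⟩
  have hint : IsIntegral ℚ ζ := (hζ.isIntegral hN).tower_top
  have : IsCyclotomicExtension {N} ℚ (IntermediateField.adjoin ℚ {ζ}) := by
    change IsCyclotomicExtension {N} ℚ (IntermediateField.adjoin ℚ {ζ}).toSubalgebra
    rw [IntermediateField.adjoin_simple_toSubalgebra_of_isAlgebraic hint.isAlgebraic]
    exact hζ.adjoin_isCyclotomicExtension ℚ
  have : NumberField (IntermediateField.adjoin ℚ {ζ}) :=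
    IsCyclotomicExtension.numberField {N} ℚ _
  set v : IntermediateField.adjoin ℚ {ζ} := ⟨u, hu⟩ with hv
  have hvr : v ^ r = 1 := by
    apply Subtype.ext; simpa using hur
  have h1 : IsPrimitiveRoot v (orderOf v) := IsPrimitiveRoot.orderOf v
  have : NeZero (orderOf v) := ⟨(orderOf_pos_iff.2 (isOfFinOrder_iff_pow_eq_one.2 ⟨r, hr, hvr⟩)).ne'⟩
  have h2 := NumberField.Units.dvd_torsionOrder_of_isPrimitiveRoot h1
  rw [IsCyclotomicExtension.Rat.torsionOrder_eq (n := N), if_pos hev] at h2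
  have h3 := orderOf_dvd_iff_pow_eq_one.1 h2
  simpa [hv, Subtype.ext_iff] using h3

theorem mem_adjoin_of_pow_eq_one {N : ℕ} (hN : 0 < N) {ζ : ℂ}
    (hζ : IsPrimitiveRoot ζ N) {u : ℂ} (hu : u ^ N = 1) : u ∈ IntermediateField.adjoin ℚ {ζ} := by
  have : NeZero N := ⟨hN.ne'⟩
  obtain ⟨i, -, rfl⟩ := hζ.eq_pow_of_pow_eq_one hu
  exact pow_mem (IntermediateField.mem_adjoin_simple_self ℚ ζ) i

/-- Homomorphisms to the units of a field extension only depend on the rational group algebra. -/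
def monoidHomCongr {G H : Type*} [Group G] [Group H]
    (e : MonoidAlgebra ℚ G ≃ₐ[ℚ] MonoidAlgebra ℚ H) (K : Type*) [Field K] [Algebra ℚ K] :
    (G →* K) ≃ (H →* K) :=
  (MonoidAlgebra.lift ℚ K G).trans
    ((e.arrowCongr AlgEquiv.refl).trans (MonoidAlgebra.lift ℚ K H).symm)

theorem card_commutator_mul [Finite G] :
    Nat.card (commutator G) * Nat.card (G →* ℂ) = Nat.card G := by
  have h1 : Nat.card (G →* ℂ) = Nat.card (Abelianization G →* ℂˣ) :=
    Nat.card_congr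
      { toFun := fun f => Abelianization.lift f.toHomUnits
        invFun := fun f => (Units.coeHom ℂ).comp (f.comp Abelianization.of)
        left_inv := fun f => by ext g; simp
        right_inv := fun f => by ext g; simp }
  rw [h1, CommGroup.card_monoidHom_of_hasEnoughRootsOfUnity]
  exact Subgroup.card_mul_index (commutator G)

theorem finrank_monoidAlgebra {M : Type*} [Finite M] (K : Type*) [Field K] :
    Module.finrank K (MonoidAlgebra K M) = Nat.card M := by
  have := Fintype.ofFinite M
  rw [(MonoidAlgebra.coeffLinearEquiv K).finrank_eq, Module.finrank_finsupp_self,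
    Nat.card_eq_fintype_card]

theorem card_eq_of_algEquiv {G H : Type*} [Group G] [Group H] [Finite G] [Finite H]
    (e : MonoidAlgebra ℚ G ≃ₐ[ℚ] MonoidAlgebra ℚ H) : Nat.card G = Nat.card H := by
  have := e.toLinearEquiv.finrank_eq
  rwa [finrank_monoidAlgebra, finrank_monoidAlgebra] at this

instance finite_monoidHom_field [Finite G] (K : Type*) [Field K] : Finite (G →* K) := by
  have := linearIndependent_monoidHom G K
  exact this.finite

theorem sq_eq_one_of_pow_eq_one {u : ℚ} {r : ℕ} (hr : 0 < r) (hu : u ^ r = 1) : u ^ 2 = 1 := by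
  have h1 : |u| ^ r = 1 := by rw [← abs_pow, hu, abs_one]
  have h2 : |u| = 1 := (pow_eq_one_iff_of_nonneg (abs_nonneg u) hr.ne').1 h1
  rw [← sq_abs, h2, one_pow]

namespace MetaPres

variable {x b : G} {m n k t : ℕ}

theorem hom_ext (h : MetaPres x b m n k t) {M : Type*} [Monoid M] {f f' : G →* M}
    (hx : f x = f' x) (hb : f b = f' b) : f = f' := by
  ext g
  obtain ⟨i, l, rfl⟩ := h.gen g
  simp [hx, hb]

theorem sq_le_card_hom [Finite G] (h : MetaPres x b m n k t) {K : Type*} [Field K] {r : ℕ}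
    (hm : r ∣ m) (hn : r ∣ n) (hk : r ∣ k) (ht : t ≡ 1 [MOD r]) {ζ : K}
    (hζ : IsPrimitiveRoot ζ r) : r * r ≤ Nat.card (G →* K) := by
  rcases Nat.eq_zero_or_pos r with rfl | hr
  · simp
  have hu : IsPrimitiveRoot (hζ.isUnit hr.ne').unit r := hζ.isUnit_unit hr.ne'
  set u := (hζ.isUnit hr.ne').unit
  have hp : ∀ (s i : ℕ), r ∣ s → (u ^ i) ^ s = 1 := by
    rintro s i ⟨q, rfl⟩
    rw [← pow_mul, mul_left_comm, pow_mul, hu.pow_eq_one, one_pow]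
  have key : ∀ p : Fin r × Fin r, ∃ φ : G →* Kˣ, φ x = u ^ (p.1 : ℕ) ∧ φ b = u ^ (p.2 : ℕ) := by
    intro p
    refine h.exists_hom (hp _ _ hm) ((hp _ _ hn).trans (hp _ _ hk).symm) ?_
    rw [mul_right_comm, inv_mul_cancel, one_mul, ← pow_mul, pow_eq_pow_iff_modEq, ← hu.eq_orderOf]
    simpa using (Nat.ModEq.mul_left (p.1 : ℕ) ht).symm
  choose φ hφx hφb using key
  have hinj : Function.Injective (fun p => (Units.coeHom K).comp (φ p)) := by
    intro p p' e
    have e1 : φ p = φ p' := by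
      ext g
      exact congrArg (fun f : G →* K => f g) e
    have e2 := hφx p
    have e3 := hφb p
    rw [e1, hφx] at e2
    rw [e1, hφb] at e3
    exact Prod.ext (Fin.ext (hu.pow_inj p'.1.2 p.1.2 e2).symm)
      (Fin.ext (hu.pow_inj p'.2.2 p.2.2 e3).symm)
  have := Nat.card_le_card_of_injective _ hinj
  simpa using this

theorem even_of_four_le_card_hom [Finite G] (h : MetaPres x b m n k t)
    (hc : 4 ≤ Nat.card (G →* ℚ)) : Even k ∧ Even n := by
  have hsq : ∀ (f : G →* ℚ) (g : G), f g ^ 2 = 1 := by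
    intro f g
    refine sq_eq_one_of_pow_eq_one (r := Nat.card G) Nat.card_pos ?_
    rw [← map_pow, pow_card_eq_one', map_one]
  have hpm : ∀ (f : G →* ℚ) (g : G), f g = 1 ∨ f g = -1 := fun f g =>
    sq_eq_one_iff.1 (hsq f g)
  have hodd : ∀ (f : G →* ℚ) (g : G) (i : ℕ), ¬ Even i → f g ^ i = f g := by
    intro f g i hi
    obtain ⟨q, rfl⟩ := Nat.not_even_iff_odd.1 hi
    rw [pow_succ, pow_mul, hsq, one_pow, one_mul]
  have hrel : ∀ f : G →* ℚ, f b ^ n = f x ^ k := fun f => by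
    rw [← map_pow, ← map_pow, h.pow]
  have hle : ∀ y : G, (∀ f f' : G →* ℚ, f y = f' y → f = f') → Nat.card (G →* ℚ) ≤ 2 := by
    intro y hy
    have hinj : Function.Injective (fun f : G →* ℚ => decide (f y = 1)) := by
      intro f f' e
      refine hy f f' ?_
      simp only [decide_eq_decide] at e
      rcases hpm f y with h1 | h1 <;> rcases hpm f' y with h2 | h2 <;> rw [h1, h2] at e ⊢ <;>
        norm_num at e
    simpa using Nat.card_le_card_of_injective _ hinj
  constructor
  · by_contra hk
    have := hle b fun f f' e => h.hom_ext (by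
      rw [← hodd f x k hk, ← hodd f' x k hk, ← hrel, ← hrel, e]) e
    omega
  · by_contra hn
    have := hle x fun f f' e => h.hom_ext e (by
      rw [← hodd f b n hn, ← hodd f' b n hn, hrel, hrel, e])
    omega

theorem card_hom_le [Finite G] (h : MetaPres x b m n k t) (ht : t % 4 = 3) {K : Type*} [Field K]
    {ζ : K} (hζ : IsPrimitiveRoot ζ 4)
    (hK : ∀ (u : K) (r : ℕ), 0 < r → u ^ r = 1 → u ^ 4 = 1) : Nat.card (G →* K) ≤ 8 := by
  have h4 : ∀ (f : G →* K) (g : G), f g ^ 4 = 1 := by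
    intro f g
    refine hK _ (Nat.card G) Nat.card_pos ?_
    rw [← map_pow, pow_card_eq_one', map_one]
  have hx : ∀ f : G →* K, f x = 1 ∨ f x = -1 := by
    intro f
    have e1 : f x ^ t = f x := by
      have := h.pow_mul_pow 1 1
      rw [pow_one, pow_one, pow_one, one_mul] at this
      have e := congrArg f this
      rw [map_mul, map_mul, map_pow, mul_comm] at e
      refine (mul_left_cancel₀ ?_ e).symm
      intro h0
      have := h4 f b
      rw [h0] at this
      norm_num at this
    have e2 : f x ^ 3 = f x := by
      rw [← Nat.div_add_mod t 4, ht, pow_add, pow_mul, h4, one_pow, one_mul] at e1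
      exact e1
    have e3 : (f x) ^ 2 = 1 := by
      rw [← h4 f x, pow_succ _ 3, e2, sq]
    exact sq_eq_one_iff.1 e3
  have : NeZero 4 := ⟨by norm_num⟩
  choose j hj hjf using fun f : G →* K => hζ.eq_pow_of_pow_eq_one (h4 f b)
  have hinj : Function.Injective
      (fun f : G →* K => ((decide (f x = 1), ⟨j f, hj f⟩) : Bool × Fin 4)) := by
    intro f f' e
    simp only [Prod.mk.injEq, decide_eq_decide, Fin.mk.injEq] at e
    refine h.hom_ext ?_ (by rw [← hjf f, ← hjf f', e.2])
    by_cases h1 : f x = 1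
    · rw [h1, e.1.1 h1]
    · have h2 : ¬ f' x = 1 := fun h2 => h1 (e.1.2 h2)
      rw [(hx f).resolve_left h1, (hx f').resolve_left h2]
  simpa using Nat.card_le_card_of_injective _ hinj

end MetaPres

open scoped commutatorElement

namespace MetaPres

variable {x b : G} {m n k t : ℕ}

theorem inv_mul_pow_mul (h : MetaPres x b m n k t) (i l s : ℕ) :
    (b ^ i * x ^ l)⁻¹ * x ^ s * (b ^ i * x ^ l) = x ^ (s * t ^ i) := by
  have := h.pow_mul_pow i s
  calc _ = (x ^ l)⁻¹ * (b ^ i)⁻¹ * (x ^ s * b ^ i) * x ^ l := by group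
    _ = (x ^ l)⁻¹ * x ^ (s * t ^ i) * x ^ l := by rw [this]; group
    _ = _ := by rw [mul_assoc, ← pow_add, add_comm, pow_add]; group

theorem isOfFinOrder (h : MetaPres x b m n k t) : IsOfFinOrder x := by
  rw [← orderOf_pos_iff, h.ord]; exact h.mpos

theorem normal_zpowers_pow (h : MetaPres x b m n k t) (s : ℕ) :
    (Subgroup.zpowers (x ^ s)).Normal := by
  refine ⟨fun y hy g => ?_⟩
  obtain ⟨l, rfl⟩ := (h.isOfFinOrder.pow.mem_powers_iff_mem_zpowers).2 hy
  obtain ⟨i, l', e⟩ := h.gen g⁻¹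
  have e2 := h.inv_mul_pow_mul i l' (s * l)
  rw [← e, inv_inv] at e2
  simp only [← pow_mul]
  rw [e2, mul_assoc s, pow_mul]
  exact Subgroup.npow_mem_zpowers _ _

theorem commutator_le (h : MetaPres x b m n k t) (N : Subgroup G) [hN : N.Normal]
    (hx : x ^ (t - 1) ∈ N) : commutator G ≤ N := by
  have hc : Commute (x : G ⧸ N) (b : G ⧸ N) := by
    have h1 := h.pow_mul_pow 1 1
    simp only [pow_one, one_mul] at h1
    change (x : G ⧸ N) * (b : G ⧸ N) = _
    rw [← QuotientGroup.mk_mul, h1, ← Nat.sub_add_cancel h.tpos, pow_succ, QuotientGroup.mk_mul,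
      QuotientGroup.mk_mul, (QuotientGroup.eq_one_iff _).2 hx, one_mul]
  have : IsMulCommutative (G ⧸ N) := by
    refine ⟨⟨fun p q => ?_⟩⟩
    obtain ⟨g, rfl⟩ := QuotientGroup.mk_surjective p
    obtain ⟨g', rfl⟩ := QuotientGroup.mk_surjective q
    obtain ⟨i, l, rfl⟩ := h.gen g
    obtain ⟨i', l', rfl⟩ := h.gen g'
    simp only [QuotientGroup.mk_mul, QuotientGroup.mk_pow]
    exact ((Commute.pow_pow (Commute.refl _) i i').mul_right (hc.symm.pow_pow i l')).mul_left
      ((hc.pow_pow l i').mul_right (Commute.pow_pow (Commute.refl _) l l'))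
  exact (Subgroup.Normal.quotient_commutative_iff_commutator_le).1 this

theorem commutator_eq (h : MetaPres x b m n k t) :
    commutator G = Subgroup.zpowers (x ^ (t - 1)) := by
  have := h.normal_zpowers_pow (t - 1)
  refine le_antisymm (h.commutator_le _ (Subgroup.mem_zpowers _)) ?_
  rw [Subgroup.zpowers_le]
  have : x ^ (t - 1) = ⁅x⁻¹, b⁻¹⁆ := by
    rw [commutatorElement_def, inv_inv, inv_inv, mul_assoc x⁻¹, mul_assoc x⁻¹, h.conj]
    conv_rhs => rw [← Nat.sub_add_cancel h.tpos, pow_succ']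
    simp
  rw [this]
  exact Subgroup.commutator_mem_commutator (Subgroup.mem_top _) (Subgroup.mem_top _)

theorem card_commutator (h : MetaPres x b m n k t) :
    Nat.card (commutator G) = m / m.gcd (t - 1) := by
  rw [h.commutator_eq, Nat.card_zpowers, h.isOfFinOrder.orderOf_pow, h.ord]

theorem mem_TG (h : MetaPres x b m n k t) (u : (ZMod (Nat.card (Subgroup.zpowers x)))ˣ) :
    u ∈ TG (Subgroup.zpowers x) ↔ ∃ i : ℕ, (u : ZMod (Nat.card (Subgroup.zpowers x))) = t ^ i := by
  obtain rfl : Nat.card (Subgroup.zpowers x) = m := by rw [Nat.card_zpowers, h.ord]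
  have hfin : NeZero (Nat.card (Subgroup.zpowers x)) := ⟨h.mpos.ne'⟩
  have key : TG (Subgroup.zpowers x) =
      Subgroup.zpowers (ZMod.unitOfCoprime t h.t_coprime) := by
    apply le_antisymm
    · refine (Subgroup.closure_le _).2 ?_
      rintro u ⟨g, s, hs, hg⟩
      obtain ⟨i, l, rfl⟩ := h.gen g
      have e := hg x (Subgroup.mem_zpowers x)
      have e2 := h.inv_mul_pow_mul i l 1
      rw [pow_one, e, one_mul, pow_eq_pow_iff_modEq, h.ord, ← ZMod.natCast_eq_natCast_iff] at e2
      refine ⟨i, ?_⟩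
      ext
      rw [← hs, e2]
      simp
    · rw [Subgroup.zpowers_le]
      refine Subgroup.subset_closure ⟨b, t, by simp, fun y hy => ?_⟩
      obtain ⟨l, rfl⟩ := (h.isOfFinOrder.mem_powers_iff_mem_zpowers).2 hy
      simpa [← pow_mul, mul_comm] using h.inv_mul_pow_mul 1 0 l
  rw [key, ← mem_powers_iff_mem_zpowers, Submonoid.mem_powers_iff]
  refine exists_congr fun i => ⟨fun e => by rw [← e]; simp, fun e => ?_⟩
  ext
  simp [e]

theorem resTriv_iff (h : MetaPres x b m n k t) {q : ℕ} (hq : q ∣ m) :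
    resTriv (Nat.card (Subgroup.zpowers x)) q (TG (Subgroup.zpowers x)) ↔ (t : ZMod q) = 1 := by
  obtain rfl : Nat.card (Subgroup.zpowers x) = m := by rw [Nat.card_zpowers, h.ord]
  constructor
  · intro H
    exact H (ZMod.unitOfCoprime t h.t_coprime) ((h.mem_TG _).2 ⟨1, by simp⟩) t (by simp)
  · intro H u hu s hs
    obtain ⟨i, hi⟩ := (h.mem_TG _).1 hu
    have : (s : ZMod (Nat.card (Subgroup.zpowers x))) = (t ^ i : ℕ) := by rw [hs, hi]; simp
    rw [ZMod.natCast_eq_natCast_iff] at this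
    have := (ZMod.natCast_eq_natCast_iff _ _ _).2 (this.of_dvd hq)
    rw [this]
    simp [H]

theorem resInPMOne_iff (h : MetaPres x b m n k t) {q : ℕ} (hq : q ∣ m) :
    resInPMOne (Nat.card (Subgroup.zpowers x)) q (TG (Subgroup.zpowers x)) ↔
      ((t : ZMod q) = 1 ∨ (t : ZMod q) = -1) := by
  obtain rfl : Nat.card (Subgroup.zpowers x) = m := by rw [Nat.card_zpowers, h.ord]
  constructor
  · intro H
    exact H (ZMod.unitOfCoprime t h.t_coprime) ((h.mem_TG _).2 ⟨1, by simp⟩) t (by simp)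
  · intro H u hu s hs
    obtain ⟨i, hi⟩ := (h.mem_TG _).1 hu
    have : (s : ZMod (Nat.card (Subgroup.zpowers x))) = (t ^ i : ℕ) := by rw [hs, hi]; simp
    rw [ZMod.natCast_eq_natCast_iff] at this
    have := (ZMod.natCast_eq_natCast_iff _ _ _).2 (this.of_dvd hq)
    rw [this, Nat.cast_pow]
    rcases H with H | H <;> rw [H]
    · simp
    · exact neg_one_pow_eq_or _ _

theorem eps_iff (h : MetaPres x b m n k t) :
    epsOfA (Subgroup.zpowers x) = -1 ↔ 4 ∣ m ∧ t % 4 = 3 := by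
  have hm : Nat.card (Subgroup.zpowers x) = m := by rw [Nat.card_zpowers, h.ord]
  set S := {r : ℕ | r ∣ Nat.card (Subgroup.zpowers x) ∧
    resTriv (Nat.card (Subgroup.zpowers x)) (ordCompl[2] r) (TG (Subgroup.zpowers x)) ∧
    resInPMOne (Nat.card (Subgroup.zpowers x)) (ordProj[2] r) (TG (Subgroup.zpowers x))} with hS
  have hmem : ∀ r, r ∈ S ↔ r ∣ m ∧ (t : ZMod (ordCompl[2] r)) = 1 ∧
      ((t : ZMod (ordProj[2] r)) = 1 ∨ (t : ZMod (ordProj[2] r)) = -1) := by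
    intro r
    rw [hS, Set.mem_ofPred_eq]
    constructor
    · rintro ⟨h1, h2, h3⟩
      rw [hm] at h1
      exact ⟨h1, (h.resTriv_iff ((Nat.ordCompl_dvd r 2).trans h1)).1 h2,
        (h.resInPMOne_iff ((Nat.ordProj_dvd r 2).trans h1)).1 h3⟩
    · rintro ⟨h1, h2, h3⟩
      exact ⟨hm ▸ h1, (h.resTriv_iff ((Nat.ordCompl_dvd r 2).trans h1)).2 h2,
        (h.resInPMOne_iff ((Nat.ordProj_dvd r 2).trans h1)).2 h3⟩
  have hbdd : BddAbove S := ⟨m, fun r hr => Nat.le_of_dvd h.mpos ((hmem r).1 hr).1⟩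
  have hne : S.Nonempty := by
    have e1 : ordCompl[2] 1 = 1 := by simp
    have e2 : ordProj[2] 1 = 1 := by simp
    refine ⟨1, (hmem 1).2 ⟨one_dvd m, ?_, Or.inl ?_⟩⟩
    · rw [e1]; exact Subsingleton.elim _ _
    · rw [e2]; exact Subsingleton.elim _ _
  set r := rOfA (Subgroup.zpowers x) with hr
  have hrS : r ∈ S := Nat.sSup_mem hne hbdd
  obtain ⟨h1, h2, h3⟩ := (hmem r).1 hrS
  have heps : epsOfA (Subgroup.zpowers x) = -1 ↔ ¬ (t : ZMod (ordProj[2] r)) = 1 := by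
    rw [epsOfA, ← hr, h.resTriv_iff ((Nat.ordProj_dvd r 2).trans h1)]
    split_ifs with h4 <;> simp [h4]
  rw [heps]
  have hr0 : r ≠ 0 := by
    rintro h0
    have := h.mpos
    rw [h0, zero_dvd_iff] at h1
    omega
  have hcases : ordProj[2] r = 1 ∨ ordProj[2] r = 2 ∨ 4 ∣ ordProj[2] r := by
    rcases hv : r.factorization 2 with _ | _ | v
    · simp
    · simp
    · right; right; exact ⟨2 ^ v, by ring⟩
  have h4r : 4 ∣ ordProj[2] r → 4 ∣ m := fun h4 => h4.trans ((Nat.ordProj_dvd r 2).trans h1)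
  constructor
  · intro hne1
    rcases hcases with h4 | h4 | h4
    · rw [h4] at hne1; exact absurd (Subsingleton.elim _ _) hne1
    · rw [h4] at hne1 h3; exact absurd (by simpa using h3) hne1
    · refine ⟨h4r h4, ?_⟩
      have h5 := h3.resolve_left hne1
      have h6 : ((t + 1 : ℕ) : ZMod (ordProj[2] r)) = 0 := by push_cast; rw [h5]; simp
      rw [ZMod.natCast_eq_zero_iff] at h6
      have := h4.trans h6
      omega
  · rintro ⟨h4m, ht⟩
    have h4 : 4 ∣ ordProj[2] r := by
      by_contra h4
      have hodd := Nat.not_dvd_ordCompl Nat.prime_two hr0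
      have hle : 4 * ordCompl[2] r ≤ r := by
        refine le_csSup hbdd ((hmem _).2 ⟨?_, ?_, Or.inr ?_⟩)
        · refine Nat.Coprime.mul_dvd_of_dvd_of_dvd ?_ h4m ((Nat.ordCompl_dvd r 2).trans h1)
          exact Nat.Coprime.pow_left 2 (Nat.coprime_ordCompl Nat.prime_two hr0)
        · rw [show 4 = 2 ^ 2 from rfl, Nat.ordCompl_pow_mul_of_not_dvd 2 Nat.prime_two hodd]
          exact h2
        · have : ordProj[2] (4 * ordCompl[2] r) = 4 := by
            rw [show 4 = 2 ^ 2 from rfl, Nat.ordProj_mul 2 (by norm_num)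
              (Nat.ordCompl_pos 2 hr0).ne', Nat.ordProj_self_pow Nat.prime_two,
              Nat.factorization_ordCompl]
            simp
          rw [this, ← ZMod.natCast_mod, ht]
          decide
      have hpos := Nat.ordCompl_pos 2 hr0
      have hprod := Nat.ordProj_mul_ordCompl_eq_self r 2
      rcases hcases with h5 | h5 | h5
      · have e := congrArg (· * ordCompl[2] r) h5
        simp only [hprod] at e
        omega
      · have e := congrArg (· * ordCompl[2] r) h5
        simp only [hprod] at e
        omega
      · exact h4 h5
    intro h5
    have h6 : (t : ZMod (ordProj[2] r)) = (1 : ℕ) := by rw [h5]; simp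
    rw [ZMod.natCast_eq_natCast_iff] at h6
    have := h6.of_dvd h4
    rw [Nat.ModEq, ht] at this
    omega

end MetaPres

theorem eq_one_of_pow_of_zpow {M : Type*} [Group M] {y : M} {r : ℕ} {s : ℤ} (h1 : y ^ r = 1)
    (h2 : y ^ s = 1) (h : IsCoprime (r : ℤ) s) : y = 1 := by
  obtain ⟨a, c, hac⟩ := h
  rw [← zpow_one y, ← hac, zpow_add, mul_comm a, mul_comm c, zpow_mul, zpow_mul, zpow_natCast, h1,
    h2]
  simp

namespace MetaPres

variable {x b : G} {m n k t : ℕ}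

theorem exists_fact_of_mem_sup (h : MetaPres x b m n k t) {v g : G}
    (hv : x ^ (t - 1) ∈ Subgroup.zpowers v) (hx : x ∈ Subgroup.zpowers v ⊔ Subgroup.zpowers g)
    (hb : b ∈ Subgroup.zpowers v ⊔ Subgroup.zpowers g) :
    ∃ f : MetacyclicFact G, f.A = Subgroup.zpowers v := by
  have hA : (Subgroup.zpowers v).Normal := by
    refine Subgroup.Normal.of_commutator_le (G := G) ?_
    rw [h.commutator_eq, Subgroup.zpowers_le]
    exact hv
  refine ⟨⟨Subgroup.zpowers v, Subgroup.zpowers g, hA, inferInstance, inferInstance, ?_⟩, rfl⟩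
  intro y
  obtain ⟨i, l, rfl⟩ := h.gen y
  have : b ^ i * x ^ l ∈ Subgroup.zpowers v ⊔ Subgroup.zpowers g :=
    mul_mem (pow_mem hb i) (pow_mem hx l)
  obtain ⟨p, hp, q, hq, e⟩ := Subgroup.mem_sup_of_normal_left.1 this
  exact ⟨p, hp, q, hq, e.symm⟩

theorem exists_fact_card_lt (h : MetaPres x b m n k t) (h4m : 4 ∣ m) (ht : t % 4 = 1)
    (hk : Even k) (hn : Even n) (hkn : ¬ (4 ∣ k ∧ 4 ∣ n))
    (hu : t ^ (n / 2) ≡ 1 [MOD ordCompl[2] m]) :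
    ∃ f : MetacyclicFact G, Nat.card f.A < m := by
  have hm := h.mpos
  obtain ⟨k', hk'⟩ := hk
  obtain ⟨N, hN⟩ := hn
  have hN2 : n / 2 = N := by omega
  rw [hN2] at hu
  have hu4 : t ^ N % 4 = 1 := by
    rw [Nat.pow_mod, ht]; simp
  obtain ⟨w, hw⟩ : ∃ w, 1 + t ^ N = 2 * w := ⟨(1 + t ^ N) / 2, by omega⟩
  have hwodd : Nat.Coprime w 2 := by
    rw [Nat.coprime_two_right, Nat.odd_iff]
    omega
  have hwm : Nat.Coprime w m := by
    rw [← Nat.ordProj_mul_ordCompl_eq_self m 2]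
    refine Nat.Coprime.mul_right (hwodd.pow_right _) ?_
    have h2 : Nat.Coprime (2 * w) (ordCompl[2] m) := by
      rw [← hw, Nat.Coprime, (hu.add_left 1).gcd_eq]
      exact Nat.coprime_ordCompl Nat.prime_two hm.ne'
    exact h2.coprime_mul_left
  obtain ⟨e, he⟩ : ∃ e, w * e ≡ 2 + k' * (m - 1) [MOD m] := by
    obtain ⟨c, -, hc⟩ := Nat.exists_mul_mod_eq_one_of_coprime hwm (by omega)
    refine ⟨c * (2 + k' * (m - 1)), ?_⟩
    have : w * c ≡ 1 [MOD m] := by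
      rw [Nat.ModEq, hc, Nat.mod_eq_of_lt (by omega)]
    simpa [mul_assoc] using this.mul_right (2 + k' * (m - 1))
  set v := b ^ N * x ^ e with hv
  have hv2 : v ^ 2 = x ^ 4 := by
    have h1 : v ^ 2 = x ^ (k + (e * t ^ N + e)) := by
      rw [pow_add, ← h.pow, hN, pow_add, pow_add, ← mul_assoc, mul_assoc (b ^ N), ← h.pow_mul_pow,
        sq, hv]
      group
    rw [h1, pow_eq_pow_iff_modEq, h.ord]
    have h2 : k + (e * t ^ N + e) = 2 * k' + 2 * (w * e) := by
      rw [hk', ← two_mul, ← mul_assoc, ← hw]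
      ring
    have h3 : 2 * k' + 2 * (2 + k' * (m - 1)) = 4 + m * (2 * k') := by
      obtain ⟨q, rfl⟩ : ∃ q, m = q + 1 := ⟨m - 1, by omega⟩
      simp only [Nat.add_sub_cancel]
      ring
    rw [h2]
    refine ((he.mul_left 2).add_left (2 * k')).trans ?_
    rw [h3, Nat.ModEq, Nat.add_mul_mod_self_left]
  have hvt : x ^ (t - 1) ∈ Subgroup.zpowers v := by
    have : t - 1 = 4 * (t / 4) := by omega
    rw [this, pow_mul, ← hv2, ← pow_mul]
    exact Subgroup.npow_mem_zpowers _ _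
  have hcard : Nat.card (Subgroup.zpowers v) < m := by
    rw [Nat.card_zpowers]
    have : v ^ (m / 2) = 1 := by
      obtain ⟨q, rfl⟩ := h4m
      rw [show 4 * q / 2 = 2 * q by omega, pow_mul, hv2, ← pow_mul, ← h.ord, pow_orderOf_eq_one]
    exact (orderOf_le_of_pow_eq_one (by omega) this).trans_lt (by omega)
  have key : ∃ g : G, x ∈ Subgroup.zpowers v ⊔ Subgroup.zpowers g ∧
      b ∈ Subgroup.zpowers v ⊔ Subgroup.zpowers g := by
    have hnorm : ∀ g, (Subgroup.zpowers v ⊔ Subgroup.zpowers g).Normal := by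
      intro g
      refine Subgroup.Normal.of_commutator_le (G := G) ?_
      rw [h.commutator_eq, Subgroup.zpowers_le]
      exact Subgroup.mem_sup_left hvt
    have hvq : ∀ g, (b : G ⧸ Subgroup.zpowers v ⊔ Subgroup.zpowers g) ^ N *
        (x : G ⧸ Subgroup.zpowers v ⊔ Subgroup.zpowers g) ^ e = 1 := by
      intro g
      exact (QuotientGroup.eq_one_iff v).2 (Subgroup.mem_sup_left (Subgroup.mem_zpowers v))
    have hxq : ∀ g, (x : G ⧸ Subgroup.zpowers v ⊔ Subgroup.zpowers g) ^ 4 = 1 := by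
      intro g
      refine (QuotientGroup.eq_one_iff (x ^ 4)).2 (Subgroup.mem_sup_left ?_)
      rw [← hv2]
      exact Subgroup.npow_mem_zpowers _ _
    have hgq : ∀ g, (g : G ⧸ Subgroup.zpowers v ⊔ Subgroup.zpowers g) = 1 := by
      intro g
      exact (QuotientGroup.eq_one_iff g).2 (Subgroup.mem_sup_right (Subgroup.mem_zpowers g))
    by_cases hodd : e % 2 = 1
    · refine ⟨b, ?_, Subgroup.mem_sup_right (Subgroup.mem_zpowers b)⟩
      rw [← QuotientGroup.eq_one_iff]
      have h1 := hvq b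
      rw [hgq b, one_pow, one_mul] at h1
      refine eq_one_of_pow_of_zpow (hxq b) (s := e) (by simpa using h1) ?_
      rw [Nat.isCoprime_iff_coprime]
      exact Nat.Coprime.pow_left 2 (Nat.coprime_two_left.2 (Nat.odd_iff.2 hodd))
    · have hk4 : 4 ∣ k := by
        have h1 := he.of_dvd (show 2 ∣ m by omega)
        have h2 : w * e % 2 = 0 := by
          rw [Nat.mul_mod, show e % 2 = 0 by omega]
          simp
        obtain ⟨q, rfl⟩ : ∃ q, m = 2 * q + 2 := ⟨m / 2 - 1, by omega⟩
        have h3 : k' * (2 * q + 2 - 1) = 2 * (k' * q) + k' := by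
          rw [show 2 * q + 2 - 1 = 2 * q + 1 by omega]
          ring
        rw [Nat.ModEq, h2, h3] at h1
        omega
      have hNodd : N % 2 = 1 := by
        by_contra hN'
        exact hkn ⟨hk4, by omega⟩
      set g := x * b ^ 4 with hg
      have h1 := hvq g
      have h2 := hgq g
      have h3 := hxq g
      have hx1 : (x : G ⧸ Subgroup.zpowers v ⊔ Subgroup.zpowers g) =
          (b : G ⧸ Subgroup.zpowers v ⊔ Subgroup.zpowers g) ^ (-4 : ℤ) := by
        have : (x : G ⧸ Subgroup.zpowers v ⊔ Subgroup.zpowers g) *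
          (b : G ⧸ Subgroup.zpowers v ⊔ Subgroup.zpowers g) ^ 4 = 1 := h2
        rw [eq_inv_of_mul_eq_one_left this, zpow_neg, ← zpow_natCast]
        rfl
      have hb1 : (b : G ⧸ Subgroup.zpowers v ⊔ Subgroup.zpowers g) = 1 := by
        refine eq_one_of_pow_of_zpow (r := 16) (s := N - 4 * e) ?_ ?_ ?_
        · rw [hx1, ← zpow_natCast, ← zpow_mul] at h3
          have := congrArg (·⁻¹) h3
          simp only [← zpow_neg, inv_one] at this
          rw [← this, ← zpow_natCast]
          rfl
        · rw [hx1, ← zpow_natCast, ← zpow_natCast, ← zpow_mul, ← zpow_add] at h1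
          rw [← h1]
          congr 1
        · have : IsCoprime (2 : ℤ) (N - 4 * e) := by
            rw [Int.isCoprime_iff_gcd_eq_one, Int.gcd_comm, ← Int.isCoprime_iff_gcd_eq_one]
            refine ⟨1, -((N - 4 * e) / 2), by omega⟩
          exact this.pow_left (m := 4)
      refine ⟨g, ?_, ?_⟩
      · rw [← QuotientGroup.eq_one_iff, hx1, hb1, one_zpow]
      · rw [← QuotientGroup.eq_one_iff, hb1]
  obtain ⟨g, hg⟩ := key
  obtain ⟨f, hf⟩ := h.exists_fact_of_mem_sup hvt hg.1 hg.2
  exact ⟨f, hf ▸ hcard⟩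

end MetaPres

universe u

/-- A ring of operators on a complex vector space without proper invariant subspaces. -/
def IsIrrep {A V : Type*} [Ring A] [AddCommGroup V] [Module ℂ V] (φ : A →+* Module.End ℂ V) :
    Prop :=
  ∀ W : Submodule ℂ V, (∀ a, ∀ w ∈ W, φ a w ∈ W) → W = ⊥ ∨ W = ⊤

theorem map_single_eq {V : Type*} [AddCommGroup V] [Module ℂ V]
    (φ : MonoidAlgebra ℚ G →+* Module.End ℂ V) (g : G) (q : ℚ) :
    φ (MonoidAlgebra.single g q) = (q : ℂ) • φ (MonoidAlgebra.single g 1) := by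
  have h1 : φ.comp (algebraMap ℚ (MonoidAlgebra ℚ G)) =
      (algebraMap ℂ (Module.End ℂ V)).comp (algebraMap ℚ ℂ) := RingHom.ext_rat _ _
  have h2 : (MonoidAlgebra.single g q : MonoidAlgebra ℚ G) =
      algebraMap ℚ (MonoidAlgebra ℚ G) q * MonoidAlgebra.single g 1 := by
    rw [← Algebra.smul_def, MonoidAlgebra.smul_single', mul_one]
  have h3 := RingHom.congr_fun h1 q
  simp only [RingHom.comp_apply] at h3
  rw [h2, map_mul, h3, ← Algebra.smul_def]
  rfl

/-- The monoid homomorphism underlying an action of the rational group algebra. -/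
def toMonoidEnd {V : Type*} [AddCommGroup V] [Module ℂ V]
    (φ : MonoidAlgebra ℚ G →+* Module.End ℂ V) : G →* Module.End ℂ V :=
  (φ : MonoidAlgebra ℚ G →* Module.End ℂ V).comp (MonoidAlgebra.of ℚ G)

theorem map_single_eq_smul {V : Type*} [AddCommGroup V] [Module ℂ V]
    (φ : MonoidAlgebra ℚ G →+* Module.End ℂ V) (g : G) (q : ℚ) :
    φ (MonoidAlgebra.single g q) = (q : ℂ) • toMonoidEnd φ g :=
  map_single_eq φ g q

theorem exists_common_eigenvector {V : Type*} [AddCommGroup V] [Module ℂ V] [FiniteDimensional ℂ V]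
    [Nontrivial V] {X Y : Module.End ℂ V} (h : Commute X Y) :
    ∃ (v : V) (c d : ℂ), v ≠ 0 ∧ X v = c • v ∧ Y v = d • v := by
  obtain ⟨c, hc⟩ := Module.End.exists_eigenvalue X
  have hmaps : ∀ v ∈ X.eigenspace c, Y v ∈ X.eigenspace c := by
    intro v hv
    rw [Module.End.mem_eigenspace_iff] at hv ⊢
    have : X (Y v) = Y (X v) := LinearMap.congr_fun h.eq v
    rw [this, hv, map_smul]
  have : Nontrivial (X.eigenspace c) := Submodule.nontrivial_iff_ne_bot.2 hc
  obtain ⟨d, hd⟩ := Module.End.exists_eigenvalue (Y.restrict hmaps)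
  obtain ⟨v, hv⟩ := hd.exists_hasEigenvector
  refine ⟨v, c, d, ?_, Module.End.mem_eigenspace_iff.1 v.2, ?_⟩
  · exact fun h0 => hv.2 (Subtype.ext h0)
  · have := Module.End.mem_eigenspace_iff.1 hv.1
    simpa using congrArg Subtype.val this

namespace MetaPres

variable {x b : G} {m n k t : ℕ}

theorem eq_bot_or_top (h : MetaPres x b m n k t) {V : Type*} [AddCommGroup V] [Module ℂ V]
    {φ : MonoidAlgebra ℚ G →+* Module.End ℂ V} (hφ : IsIrrep φ) (W : Submodule ℂ V)
    (hx : ∀ w ∈ W, toMonoidEnd φ x w ∈ W) (hb : ∀ w ∈ W, toMonoidEnd φ b w ∈ W) :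
    W = ⊥ ∨ W = ⊤ := by
  refine hφ W fun a => ?_
  have hp : ∀ (X : Module.End ℂ V) (_ : ∀ w ∈ W, X w ∈ W) (i : ℕ), ∀ w ∈ W, (X ^ i) w ∈ W := by
    intro X hX i
    induction i with
    | zero => simp
    | succ i ih =>
      intro w hw
      rw [pow_succ]
      exact ih _ (hX _ hw)
  induction a using MonoidAlgebra.induction_linear with
  | zero => simp
  | add f g hf hg => 
    intro w hw
    rw [map_add]
    exact W.add_mem (hf w hw) (hg w hw)
  | single g q =>
    intro w hw
    rw [map_single_eq_smul]
    obtain ⟨i, l, rfl⟩ := h.gen g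
    rw [map_mul, map_pow, map_pow]
    exact W.smul_mem _ (hp _ hb i _ (hp _ hx l _ hw))

theorem isScalar_of_commute (h : MetaPres x b m n k t) {V : Type*} [AddCommGroup V] [Module ℂ V]
    {φ : MonoidAlgebra ℚ G →+* Module.End ℂ V} (hφ : IsIrrep φ) {Z : Module.End ℂ V}
    (hx : Commute Z (toMonoidEnd φ x)) (hb : Commute Z (toMonoidEnd φ b)) {v : V} (hv : v ≠ 0)
    {c : ℂ} (hc : Z v = c • v) (w : V) : Z w = c • w := by
  have hs : ∀ X, Commute Z X → ∀ w ∈ Z.eigenspace c, X w ∈ Z.eigenspace c := by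
    intro X hX w hw
    rw [Module.End.mem_eigenspace_iff] at hw ⊢
    have : Z (X w) = X (Z w) := LinearMap.congr_fun hX.eq w
    rw [this, hw, map_smul]
  rcases h.eq_bot_or_top hφ (Z.eigenspace c) (hs _ hx) (hs _ hb) with h1 | h1
  · exact absurd ((Submodule.eq_bot_iff _).1 h1 v (Module.End.mem_eigenspace_iff.2 hc)) hv
  · exact Module.End.mem_eigenspace_iff.1 (h1 ▸ Submodule.mem_top)

theorem map_x_apply (h : MetaPres x b m n k t) {V : Type*} [AddCommGroup V] [Module ℂ V]
    (ρ : G →* Module.End ℂ V) {v : V} {c : ℂ} (hv : ρ x v = c • v) (i : ℕ) :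
    ρ x (ρ (b ^ i) v) = c ^ t ^ i • ρ (b ^ i) v := by
  have hp : ∀ l : ℕ, ρ (x ^ l) v = c ^ l • v := by
    intro l
    induction l with
    | zero => simp
    | succ l ih => rw [pow_succ, map_mul, Module.End.mul_apply, hv, map_smul, ih, smul_smul, pow_succ']
  have := h.pow_mul_pow i 1
  rw [pow_one, one_mul] at this
  rw [← Module.End.mul_apply, ← map_mul, this, map_mul, Module.End.mul_apply, hp, map_smul]

theorem orderOf_pos (h : MetaPres x b m n k t) : 0 < orderOf (t : ZMod m) := by
  rw [orderOf_pos_iff, isOfFinOrder_iff_pow_eq_one]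
  refine ⟨n, h.npos, ?_⟩
  rw [← Nat.cast_pow, ← Nat.cast_one, ZMod.natCast_eq_natCast_iff]
  exact h.t_pow_n

theorem commute_x_pow_orderOf (h : MetaPres x b m n k t) : Commute x (b ^ orderOf (t : ZMod m)) := by
  have h1 : t ^ orderOf (t : ZMod m) ≡ 1 [MOD m] := by
    rw [← ZMod.natCast_eq_natCast_iff, Nat.cast_pow, Nat.cast_one, pow_orderOf_eq_one]
  have h2 := h.pow_mul_pow (orderOf (t : ZMod m)) 1
  rw [pow_one, one_mul] at h2
  rw [commute_iff_eq, h2]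
  congr 1
  rw [← pow_one x, ← pow_mul, one_mul, pow_eq_pow_iff_modEq, h.ord]
  exact h1

theorem le_finrank (h : MetaPres x b m n k t) {V : Type*} [AddCommGroup V] [Module ℂ V]
    [FiniteDimensional ℂ V] (ρ : G →* Module.End ℂ V) {v : V} (hv0 : v ≠ 0) {ζ : ℂ}
    (hζ : IsPrimitiveRoot ζ m) (hv : ρ x v = ζ • v) :
    orderOf (t : ZMod m) ≤ Module.finrank ℂ V := by
  have hli : LinearIndependent ℂ (fun i : Fin (orderOf (t : ZMod m)) => ρ (b ^ (i : ℕ)) v) := by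
    refine Module.End.eigenvectors_linearIndependent' (ρ x) 
      (fun i : Fin (orderOf (t : ZMod m)) => ζ ^ t ^ (i : ℕ)) ?_ _ ?_
    · intro i i' e
      simp only at e
      rw [← pow_mod_orderOf, ← pow_mod_orderOf ζ (t ^ (i' : ℕ)), ← hζ.eq_orderOf] at e
      have e := hζ.pow_inj (Nat.mod_lt _ h.mpos) (Nat.mod_lt _ h.mpos) e
      change _ ≡ _ [MOD m] at e
      rw [← ZMod.natCast_eq_natCast_iff, Nat.cast_pow,
        Nat.cast_pow] at e
      exact Fin.ext (pow_injOn_Iio_orderOf i.2 i'.2 e)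
    · intro i
      refine ⟨Module.End.mem_eigenspace_iff.2 (h.map_x_apply ρ hv i), fun h0 => hv0 ?_⟩
      have : ρ (b ^ (i : ℕ))⁻¹ (ρ (b ^ (i : ℕ)) v) = v := by
        rw [← Module.End.mul_apply, ← map_mul, inv_mul_cancel, map_one, Module.End.one_apply]
      rw [← this, h0, map_zero]
  simpa using hli.fintype_card_le_finrank

/-- An irreducible action of a metacyclic group has dimension at most the order of `t`, and when
this bound is attained, scalars by which group algebra elements act on a suitable vector lie in any
field containing two eigenvalues. -/
theorem exists_vector (h : MetaPres x b m n k t) {V : Type*} [AddCommGroup V] [Module ℂ V]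
    [FiniteDimensional ℂ V] [Nontrivial V] {φ : MonoidAlgebra ℚ G →+* Module.End ℂ V}
    (hφ : IsIrrep φ) :
    Module.finrank ℂ V ≤ orderOf (t : ZMod m) ∧
    ∃ (v : V) (c d : ℂ), v ≠ 0 ∧ toMonoidEnd φ x v = c • v ∧
      toMonoidEnd φ (b ^ orderOf (t : ZMod m)) v = d • v ∧
      (Module.finrank ℂ V = orderOf (t : ZMod m) → ∀ F : IntermediateField ℚ ℂ, c ∈ F → d ∈ F →
        ∀ (z : MonoidAlgebra ℚ G) (s : ℂ), φ z v = s • v → s ∈ F) := by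
  set j := orderOf (t : ZMod m) with hj
  have hjpos : 0 < j := h.orderOf_pos
  set ρ := toMonoidEnd φ with hρ
  obtain ⟨v, c, d, hv0, hc, hd⟩ := exists_common_eigenvector (h.commute_x_pow_orderOf.map ρ)
  rw [← hj] at hd
  have hbpow : ∀ r a : ℕ, ρ (b ^ (r + j * a)) v = d ^ a • ρ (b ^ r) v := by
    intro r a
    induction a with
    | zero => simp
    | succ a ih =>
      rw [mul_add, mul_one, ← add_assoc, pow_add, map_mul, Module.End.mul_apply, hd, map_smul, ih,
        smul_smul, pow_succ']
  have hxpow : ∀ l : ℕ, ρ (x ^ l) v = c ^ l • v := by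
    intro l
    induction l with
    | zero => simp
    | succ l ih => 
      rw [pow_succ, map_mul, Module.End.mul_apply, hc, map_smul, ih, smul_smul, pow_succ']
  set B : Fin j → V := fun i => ρ (b ^ (i : ℕ)) v with hB
  have hspan : Submodule.span ℂ (Set.range B) = ⊤ := by
    have hstab : ∀ X : Module.End ℂ V, (∀ i, X (B i) ∈ Submodule.span ℂ (Set.range B)) →
        ∀ w ∈ Submodule.span ℂ (Set.range B), X w ∈ Submodule.span ℂ (Set.range B) := by
      intro X hX w hw
      induction hw using Submodule.span_induction with
      | mem y hy => obtain ⟨i, rfl⟩ := hy; exact hX i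
      | zero => simp
      | add y z _ _ hy hz => rw [map_add]; exact Submodule.add_mem _ hy hz
      | smul a y _ hy => rw [map_smul]; exact Submodule.smul_mem _ _ hy
    refine (h.eq_bot_or_top hφ _ (hstab _ fun i => ?_) (hstab _ fun i => ?_)).resolve_left ?_
    · rw [hB, h.map_x_apply ρ hc]
      exact Submodule.smul_mem _ _ (Submodule.subset_span ⟨i, rfl⟩)
    · simp only [hB]
      rw [← Module.End.mul_apply, ← map_mul, ← pow_succ', ← Nat.mod_add_div ((i : ℕ) + 1) j, hbpow]
      exact Submodule.smul_mem _ _ (Submodule.subset_span ⟨⟨_, Nat.mod_lt _ hjpos⟩, rfl⟩)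
    · intro h0
      refine hv0 ((Submodule.eq_bot_iff _).1 h0 v (Submodule.subset_span ⟨⟨0, hjpos⟩, ?_⟩))
      simp [hB]
  refine ⟨?_, v, c, d, hv0, hc, hd, ?_⟩
  · have := finrank_range_le_card (R := ℂ) B
    rw [Set.finrank, hspan, finrank_top] at this
    simpa using this
  · intro hdim F hcF hdF z s hs
    have hli : LinearIndependent ℂ B :=
      linearIndependent_of_top_le_span_of_card_eq_finrank hspan.ge (by simp [hdim])
    set bas := Module.Basis.mk hli hspan.ge with hbas
    have hcoord : ∀ i, bas.coord ⟨0, hjpos⟩ (B i) = if i = ⟨0, hjpos⟩ then 1 else 0 := by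
      intro i
      have : B i = bas i := by rw [hbas, Module.Basis.mk_apply]
      rw [this, Module.Basis.coord_apply, Module.Basis.repr_self, Finsupp.single_apply]
    have hv : v = B ⟨0, hjpos⟩ := by simp [hB]
    have key : ∀ z : MonoidAlgebra ℚ G, bas.coord ⟨0, hjpos⟩ (φ z v) ∈ F := by
      intro z
      induction z using MonoidAlgebra.induction_linear with
      | zero => simp
      | add f g hf hg =>
        rw [map_add, LinearMap.add_apply, map_add]
        exact F.add_mem hf hg
      | single g q =>
        obtain ⟨i, l, rfl⟩ := h.gen g
        rw [map_single_eq_smul, ← hρ, map_mul, LinearMap.smul_apply, Module.End.mul_apply, hxpow,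
          map_smul, map_smul, ← Nat.mod_add_div i j, hbpow, map_smul, map_smul]
        have e := hcoord ⟨i % j, Nat.mod_lt _ hjpos⟩
        simp only [hB] at e
        rw [e]
        simp only [smul_eq_mul]
        refine F.mul_mem (F.algebraMap_mem q) (F.mul_mem (pow_mem hcF _)
          (F.mul_mem (pow_mem hdF _) ?_))
        split_ifs
        exacts [F.one_mem, F.zero_mem]
    have := key z
    rw [hs, map_smul, hv, hcoord, if_pos rfl, smul_eq_mul, mul_one] at this
    exact this

theorem exists_irrep {G : Type u} [Group G] [Finite G] {x b : G} (h : MetaPres x b m n k t)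
    {ζ : ℂ} (hζ : IsPrimitiveRoot ζ m) :
    ∃ (V : Type u) (_ : AddCommGroup V) (_ : Module ℂ V) (_ : FiniteDimensional ℂ V)
      (_ : Nontrivial V) (φ : MonoidAlgebra ℚ G →+* Module.End ℂ V) (v : V),
      IsIrrep φ ∧ v ≠ 0 ∧ toMonoidEnd φ x v = ζ • v := by
  set y : MonoidAlgebra ℂ G := MonoidAlgebra.single x 1 - algebraMap ℂ (MonoidAlgebra ℂ G) ζ with hy
  set w : MonoidAlgebra ℂ G := ∑ i ∈ Finset.range m, MonoidAlgebra.single (x ^ i) (ζ⁻¹ ^ i) with hw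
  have hζ0 : ζ ≠ 0 := hζ.ne_zero h.mpos.ne'
  have hyw : y * w = 0 := by
    have e1 : ∀ i, MonoidAlgebra.single x (1 : ℂ) * MonoidAlgebra.single (x ^ i) (ζ⁻¹ ^ i) =
        ζ • MonoidAlgebra.single (x ^ (i + 1)) (ζ⁻¹ ^ (i + 1)) := by
      intro i
      rw [MonoidAlgebra.single_mul_single, one_mul, ← pow_succ', MonoidAlgebra.smul_single',
        pow_succ' ζ⁻¹, mul_inv_cancel_left₀ hζ0]
    rw [hy, sub_mul, sub_eq_zero, ← Algebra.smul_def, hw, Finset.mul_sum, Finset.smul_sum]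
    simp only [e1]
    rw [← Finset.smul_sum, ← Finset.smul_sum]
    congr 1
    have e2 := Finset.sum_range_succ (fun i => (MonoidAlgebra.single (x ^ i) (ζ⁻¹ ^ i) : MonoidAlgebra ℂ G)) m
    have e3 : x ^ m = 1 := by rw [← h.ord, pow_orderOf_eq_one]
    rw [Finset.sum_range_succ', e3, inv_pow ζ m, hζ.pow_eq_one] at e2
    simpa using e2
  have hw0 : w ≠ 0 := by
    intro h0
    have e := congrArg (fun f : MonoidAlgebra ℂ G => f.coeff 1) h0
    simp only [hw, MonoidAlgebra.coeff_sum, Finsupp.finsetSum_apply, MonoidAlgebra.coeff_single,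
      Finsupp.single_apply] at e
    rw [Finset.sum_eq_single 0] at e
    · simp at e
    · intro i hi hi0
      rw [if_neg]
      exact fun h1 => pow_ne_one_of_lt_orderOf hi0 (by rw [h.ord]; exact Finset.mem_range.1 hi) h1
    · intro h1
      exact absurd (Finset.mem_range.2 h.mpos) h1
  have hJ0 : Ideal.span {y} ≠ ⊤ := by
    rw [Ne, Ideal.eq_top_iff_one, Ideal.mem_span_singleton']
    rintro ⟨a, ha⟩
    have : a * y * w = w := by rw [ha, one_mul]
    rw [mul_assoc, hyw, mul_zero] at this
    exact hw0 this.symm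
  obtain ⟨J, hJ, hJle⟩ := Ideal.exists_le_maximal _ hJ0
  have hfin : FiniteDimensional ℂ (MonoidAlgebra ℂ G) :=
    Module.Finite.equiv (MonoidAlgebra.coeffLinearEquiv ℂ).symm
  have hsimple : IsSimpleModule (MonoidAlgebra ℂ G) (MonoidAlgebra ℂ G ⧸ J) := isSimpleModule_iff_isCoatom.2 hJ.out
  have hnt : Nontrivial (MonoidAlgebra ℂ G ⧸ J) := IsSimpleModule.nontrivial (MonoidAlgebra ℂ G) (MonoidAlgebra ℂ G ⧸ J)
  set φ : MonoidAlgebra ℚ G →+* Module.End ℂ (MonoidAlgebra ℂ G ⧸ J) :=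
    (Algebra.lsmul ℂ ℂ (MonoidAlgebra ℂ G ⧸ J) : MonoidAlgebra ℂ G →ₐ[ℂ] Module.End ℂ (MonoidAlgebra ℂ G ⧸ J)).toRingHom.comp
      (MonoidAlgebra.mapRingHom G (algebraMap ℚ ℂ)) with hφ
  have hφg : ∀ (g : G) (u : MonoidAlgebra ℂ G ⧸ J),
      toMonoidEnd φ g u = (MonoidAlgebra.single g 1 : MonoidAlgebra ℂ G) • u := by
    intro g u
    simp [toMonoidEnd, hφ]
  refine ⟨MonoidAlgebra ℂ G ⧸ J, inferInstance, inferInstance, inferInstance, hnt, φ,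
    (Submodule.Quotient.mk 1), ?_, ?_, ?_⟩
  · intro W hW
    let W' : Submodule (MonoidAlgebra ℂ G) (MonoidAlgebra ℂ G ⧸ J) :=
      { W.toAddSubmonoid with
        smul_mem' := by
          intro a u hu
          induction a using MonoidAlgebra.induction_linear with
          | zero => simp
          | add f g hf hg =>
            rw [add_smul]
            exact W.add_mem hf hg
          | single g q =>
            have e : (MonoidAlgebra.single g q : MonoidAlgebra ℂ G) = q • MonoidAlgebra.single g 1 := by
              rw [MonoidAlgebra.smul_single', mul_one]
            rw [e, smul_assoc, ← hφg]
            exact W.smul_mem q (hW _ u hu) }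
    rcases eq_bot_or_eq_top W' with h1 | h1
    · left
      rw [Submodule.eq_bot_iff] at h1 ⊢
      exact h1
    · right
      rw [Submodule.eq_top_iff'] at h1 ⊢
      exact h1
  · intro h0
    rw [Submodule.Quotient.mk_eq_zero] at h0
    exact hJ.ne_top ((Ideal.eq_top_iff_one J).2 h0)
  · rw [hφg, ← Submodule.Quotient.mk_smul, ← Submodule.Quotient.mk_smul, Submodule.Quotient.eq]
    refine hJle (Ideal.subset_span ?_)
    simp [hy, Algebra.smul_def]

end MetaPres

theorem sum_pow_eq_ite {η : ℂ} {o : ℕ} (ho : 0 < o) (hη : IsPrimitiveRoot η o) (a : ℕ) :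
    ∑ l ∈ Finset.range o, η⁻¹ ^ l * η ^ (l * a) = if a ≡ 1 [MOD o] then (o : ℂ) else 0 := by
  have hη0 : η ≠ 0 := hη.ne_zero ho.ne'
  have e : ∀ l, η⁻¹ ^ l * η ^ (l * a) = (η⁻¹ * η ^ a) ^ l := by
    intro l
    rw [mul_pow, mul_comm l, pow_mul]
  simp only [e]
  have hiff : η⁻¹ * η ^ a = 1 ↔ a ≡ 1 [MOD o] := by
    rw [inv_mul_eq_one₀ hη0, ← pow_mod_orderOf η a, ← hη.eq_orderOf]
    have e2 : η = η ^ (1 % o) := by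
      conv_rhs => rw [hη.eq_orderOf, pow_mod_orderOf, pow_one]
    constructor
    · intro h1
      exact (hη.pow_inj (Nat.mod_lt _ ho) (Nat.mod_lt _ ho) (e2.symm.trans h1)).symm
    · intro h1
      rw [h1, ← e2]
  split_ifs with h1
  · rw [hiff.2 h1]
    simp
  · have h2 : η⁻¹ * η ^ a ≠ 1 := fun h3 => h1 (hiff.1 h3)
    rw [geom_sum_eq h2, mul_pow, ← pow_mul, mul_comm a, pow_mul, inv_pow, hη.pow_eq_one]
    simp

/-- Orbit sums of a primitive root of unity generate its `2`-part over the odd cyclotomic field when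
the stabilizer of the odd part fixes the `2`-part. -/
theorem pow_mem_of_sum_mem {f o n t : ℕ} (ho : 0 < o) (hn : 0 < n) {ζ : ℂ}
    (hζ : IsPrimitiveRoot ζ (2 ^ f * o)) (ht : 0 < t) (ht2 : 2 ^ f ∣ 2 * (t - 1))
    (hst : ∀ i, t ^ i ≡ 1 [MOD o] → t ^ i ≡ 1 [MOD 2 ^ f]) {F : IntermediateField ℚ ℂ}
    (hη : ζ ^ 2 ^ f ∈ F) (hsum : ∀ s, ∑ i ∈ Finset.range n, ζ ^ (s * t ^ i) ∈ F) :
    ζ ^ o ∈ F := by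
  have hpos : 0 < 2 ^ f * o := Nat.mul_pos (by positivity) ho
  have hη' : IsPrimitiveRoot (ζ ^ 2 ^ f) o := hζ.pow hpos rfl
  have hξ' : IsPrimitiveRoot (ζ ^ o) (2 ^ f) := hζ.pow hpos (mul_comm _ _)
  set η := ζ ^ 2 ^ f with hηdef
  set ξ := ζ ^ o with hξdef
  have hξ0 : ξ ≠ 0 := hξ'.ne_zero (by positivity)
  have hη0 : η ≠ 0 := hη'.ne_zero ho.ne'
  set ε : ℕ → ℂ := fun i => ξ ^ (t ^ i - 1) with hε
  have hεξ : ∀ i, ξ ^ t ^ i = ξ * ε i := by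
    intro i
    have : 1 ≤ t ^ i := Nat.one_le_pow _ _ ht
    rw [hε, ← pow_succ', Nat.sub_add_cancel this]
  have hεF : ∀ i, ε i ∈ F := by
    intro i
    have h1 : ε i ^ 2 = 1 := by
      have h2 : t - 1 ∣ t ^ i - 1 := by simpa using Nat.sub_dvd_pow_sub_pow t 1 i
      rw [hε, ← pow_mul, mul_comm]
      exact (hξ'.pow_eq_one_iff_dvd _).2 (ht2.trans (Nat.mul_dvd_mul_left 2 h2))
    rcases sq_eq_one_iff.1 h1 with h2 | h2 <;> rw [h2]
    · exact F.one_mem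
    · exact F.neg_mem F.one_mem
  have hε1 : ∀ i, t ^ i ≡ 1 [MOD o] → ε i = 1 := by
    intro i hi
    refine (hξ'.pow_eq_one_iff_dvd _).2 ?_
    exact (Nat.modEq_iff_dvd' (Nat.one_le_pow _ _ ht)).1 (hst i hi).symm
  set S : ℕ → ℂ := fun l => ∑ i ∈ Finset.range n, ε i * η ^ (l * t ^ i) with hS
  have hSF : ∀ l, S l ∈ F := fun l =>
    sum_mem fun i _ => F.mul_mem (hεF i) (pow_mem hη _)
  have hξS : ∀ l, ξ * S l ∈ F := by
    intro l
    have := hsum (o + 2 ^ f * l)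
    have e : ∀ i, ζ ^ ((o + 2 ^ f * l) * t ^ i) = ξ * (ε i * η ^ (l * t ^ i)) := by
      intro i
      rw [← mul_assoc, ← hεξ, hξdef, hηdef, ← pow_mul, ← pow_mul, ← pow_add]
      congr 1
      ring
    simp only [e, ← Finset.mul_sum] at this
    exact this
  have hex : ∃ l, S l ≠ 0 := by
    by_contra! h0
    have h1 : ∑ l ∈ Finset.range o, η⁻¹ ^ l * S l = 0 := by simp [h0]
    have h2 : ∑ l ∈ Finset.range o, η⁻¹ ^ l * S l =
        ∑ i ∈ Finset.range n, if t ^ i ≡ 1 [MOD o] then (o : ℂ) else 0 := by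
      simp only [hS, Finset.mul_sum]
      rw [Finset.sum_comm]
      refine Finset.sum_congr rfl fun i _ => ?_
      have h3 : ∀ l, η⁻¹ ^ l * (ε i * η ^ (l * t ^ i)) = ε i * (η⁻¹ ^ l * η ^ (l * t ^ i)) := by
        intro l; ring
      simp only [h3]
      rw [← Finset.mul_sum, sum_pow_eq_ite ho hη']
      split_ifs with h4
      · rw [hε1 i h4, one_mul]
      · rw [mul_zero]
    rw [h2, Finset.sum_ite, Finset.sum_const_zero, add_zero, Finset.sum_const, nsmul_eq_mul,
      mul_eq_zero, Nat.cast_eq_zero, Nat.cast_eq_zero, Finset.card_eq_zero] at h1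
    rcases h1 with h1 | h1
    · have : 0 ∈ (Finset.range n).filter fun i => t ^ i ≡ 1 [MOD o] := by
        simp [hn, Nat.ModEq.refl]
      rw [h1] at this
      simp at this
    · omega
  obtain ⟨l, hl⟩ := hex
  rw [← mul_div_cancel_right₀ ξ hl]
  exact F.div_mem (hξS l) (hSF l)

namespace MetaPres

variable {x b : G} {m n k t : ℕ}

theorem commute_sum_x {M : Type*} [Ring M] (ρ : G →* M) (s : ℕ) :
    Commute (∑ i ∈ Finset.range n, ρ (x ^ (s * t ^ i))) (ρ x) :=
  Commute.sum_left _ _ _ fun i _ => by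
    rw [map_pow]
    exact (Commute.refl (ρ x)).pow_left _

theorem commute_sum_b (h : MetaPres x b m n k t) {M : Type*} [Ring M] (ρ : G →* M) (s : ℕ) :
    Commute (∑ i ∈ Finset.range n, ρ (x ^ (s * t ^ i))) (ρ b) := by
  rw [commute_iff_eq, Finset.sum_mul, Finset.mul_sum]
  have e : ∀ i, ρ (x ^ (s * t ^ i)) * ρ b = ρ (b * x ^ (s * t ^ (i + 1))) := by
    intro i
    have := h.pow_mul_pow 1 (s * t ^ i)
    rw [pow_one, pow_one] at this
    rw [← map_mul, this, pow_succ, mul_assoc s]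
  simp only [e, ← map_mul]
  have h1 := Finset.sum_range_succ (fun i => ρ (b * x ^ (s * t ^ i))) n
  have h2 : x ^ (s * t ^ n) = x ^ (s * t ^ 0) := by
    rw [pow_eq_pow_iff_modEq, h.ord]
    simpa using h.t_pow_n.mul_left s
  rw [Finset.sum_range_succ', h2] at h1
  exact add_right_cancel h1

theorem sum_apply {V : Type*} [AddCommGroup V] [Module ℂ V] (ρ : G →* Module.End ℂ V) {v : V}
    {c : ℂ} (hv : ρ x v = c • v) (s : ℕ) :
    (∑ i ∈ Finset.range n, ρ (x ^ (s * t ^ i))) v =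
      (∑ i ∈ Finset.range n, c ^ (s * t ^ i)) • v := by
  have hp : ∀ l : ℕ, ρ (x ^ l) v = c ^ l • v := by
    intro l
    induction l with
    | zero => simp
    | succ l ih => rw [pow_succ, map_mul, Module.End.mul_apply, hv, map_smul, ih, smul_smul, pow_succ']
  rw [LinearMap.sum_apply, Finset.sum_smul]
  exact Finset.sum_congr rfl fun i _ => hp _

end MetaPres

namespace MetaPres

variable {x b : G} {m n k t : ℕ}

theorem t_odd (h : MetaPres x b m n k t) (hm : 2 ∣ m) : t % 2 = 1 := by
  by_contra h0
  have h1 : 2 ∣ Nat.gcd t m := Nat.dvd_gcd (by omega) hm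
  rw [h.t_coprime] at h1
  omega

theorem dvd_k_mul (h : MetaPres x b m n k t) : m ∣ k * (t - 1) := by
  have h1 := (Nat.modEq_iff_dvd' (Nat.le_mul_of_pos_right k h.tpos)).1 h.k_mul.symm
  rwa [Nat.mul_sub, mul_one]

theorem even_of_mod_four (h : MetaPres x b m n k t) (hm : 4 ∣ m) (ht : t % 4 = 3) :
    Even k ∧ Even n := by
  constructor
  · by_contra hk
    have h1 : 4 ∣ k * (t - 1) := hm.trans h.dvd_k_mul
    have h2 : Nat.Coprime 4 k := by
      rw [Nat.not_even_iff_odd] at hk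
      exact (Nat.coprime_two_left.2 hk).pow_left 2
    have := h2.dvd_of_dvd_mul_left h1
    omega
  · by_contra hn
    obtain ⟨j, rfl⟩ := Nat.not_even_iff_odd.1 hn
    have h1 : t ^ (2 * j + 1) ≡ 1 [MOD 4] := h.t_pow_n.of_dvd hm
    have h2 : t ^ 2 % 4 = 1 := by simp [Nat.pow_mod, ht]
    rw [Nat.ModEq, pow_succ, pow_mul, Nat.mul_mod, Nat.pow_mod, h2, ht] at h1
    simp at h1

theorem two_pow_dvd (h : MetaPres x b m n k t) (ht : t % 4 = 1) (hk : Even k)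
    (hn : Even n) (hkn : ¬ (4 ∣ k ∧ 4 ∣ n)) : ordProj[2] m ∣ 2 * (t - 1) := by
  have hfm : ordProj[2] m ∣ m := Nat.ordProj_dvd m 2
  by_cases hn4 : 4 ∣ n
  · have hk4 : ¬ 4 ∣ k := fun h4 => hkn ⟨h4, hn4⟩
    obtain ⟨k', hk'⟩ := hk
    have hodd : Nat.Coprime 2 k' := Nat.coprime_two_left.2 (Nat.odd_iff.2 (by omega))
    have h1 : ordProj[2] m ∣ k' * (2 * (t - 1)) := by
      have := hfm.trans h.dvd_k_mul
      rwa [hk', ← two_mul, mul_comm 2, mul_assoc] at this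
    exact (hodd.pow_left _).dvd_of_dvd_mul_left h1
  · have htp := h.tpos
    have h1 : ordProj[2] m ∣ (∑ i ∈ Finset.range n, t ^ i) * (t - 1) := by
      rw [geom_sum_mul_of_one_le htp]
      exact hfm.trans ((Nat.modEq_iff_dvd' (Nat.one_le_pow _ _ htp)).1 h.t_pow_n.symm)
    have h2 : (∑ i ∈ Finset.range n, t ^ i) % 4 = n % 4 := by
      rw [Finset.sum_nat_mod]
      simp [Nat.pow_mod, ht]
    obtain ⟨S, hS⟩ : 2 ∣ ∑ i ∈ Finset.range n, t ^ i := by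
      obtain ⟨N, hN⟩ := hn
      omega
    have hodd : Nat.Coprime 2 S := by
      obtain ⟨N, hN⟩ := hn
      exact Nat.coprime_two_left.2 (Nat.odd_iff.2 (by omega))
    rw [hS, mul_comm 2, mul_assoc] at h1
    exact (hodd.pow_left _).dvd_of_dvd_mul_left h1

theorem factorization_two_eq (h : MetaPres x b m n k t) (h4m : 4 ∣ m) (ht : t % 4 = 1)
    (h2 : ordProj[2] m ∣ 2 * (t - 1)) (heven : 2 ∣ m / m.gcd (t - 1)) :
    3 ≤ m.factorization 2 ∧ ¬ 4 ∣ m / m.gcd (t - 1) := by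
  have hm := h.mpos
  obtain ⟨f, hf⟩ : ∃ f, m.factorization 2 = f := ⟨_, rfl⟩
  obtain ⟨o, hmo⟩ : ordProj[2] m ∣ m := Nat.ordProj_dvd m 2
  have hf2 : 2 ≤ f := by
    rw [← hf]
    exact (Nat.prime_two.pow_dvd_iff_le_factorization hm.ne').1 h4m
  obtain ⟨j, rfl⟩ : ∃ j, f = j + 1 := ⟨f - 1, by omega⟩
  rw [hf] at h2 hmo ⊢
  have hj : 2 ^ j ∣ t - 1 := by
    rw [pow_succ'] at h2
    exact Nat.dvd_of_mul_dvd_mul_left two_pos h2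
  have hjg : 2 ^ j ∣ m.gcd (t - 1) :=
    Nat.dvd_gcd ⟨2 * o, by rw [← mul_assoc, ← pow_succ, ← hmo]⟩ hj
  obtain ⟨q, hq⟩ := Nat.gcd_dvd_left m (t - 1)
  have hg0 : 0 < m.gcd (t - 1) := Nat.gcd_pos_of_pos_left _ hm
  have hdiv : m / m.gcd (t - 1) = q := Nat.div_eq_of_eq_mul_right hg0 hq
  rw [hdiv] at heven ⊢
  have hno : ¬ 2 ^ (j + 2) ∣ m := by
    intro hd
    have := (Nat.prime_two.pow_dvd_iff_le_factorization hm.ne').1 hd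
    omega
  refine ⟨?_, fun h4 => ?_⟩
  · by_contra hlt
    have hj1 : j = 1 := by omega
    subst hj1
    have h4g : 4 ∣ m.gcd (t - 1) := Nat.dvd_gcd h4m (by omega)
    refine hno ?_
    rw [hq]
    exact mul_dvd_mul h4g heven
  · refine hno ?_
    rw [hq, pow_add]
    exact mul_dvd_mul hjg h4

theorem not_eight_dvd (h : MetaPres x b m n k t) (ht : t % 4 = 3)
    (h4 : ¬ 4 ∣ m / m.gcd (t - 1)) : ¬ 8 ∣ m := by
  intro h8
  have hm := h.mpos
  obtain ⟨q, hq⟩ := Nat.gcd_dvd_left m (t - 1)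
  have hg0 : 0 < m.gcd (t - 1) := Nat.gcd_pos_of_pos_left _ hm
  rw [Nat.div_eq_of_eq_mul_right hg0 hq] at h4
  have h2g : ¬ 4 ∣ m.gcd (t - 1) := by
    intro h0
    have := h0.trans (Nat.gcd_dvd_right m (t - 1))
    omega
  have h2 : 2 ∣ m.gcd (t - 1) := Nat.dvd_gcd (by omega) (by omega)
  obtain ⟨g, hg⟩ := h2
  have hgo : Nat.Coprime 2 g := Nat.coprime_two_left.2 (Nat.odd_iff.2 (by omega))
  rw [hq, hg, mul_assoc, show (8 : ℕ) = 2 * 4 by norm_num] at h8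
  exact h4 ((hgo.pow_left 2).dvd_of_dvd_mul_left (Nat.dvd_of_mul_dvd_mul_left two_pos h8))

theorem two_dvd_of_mod_four (h : MetaPres x b m n k t) (hm : 4 ∣ m) (ht : t % 4 = 3) :
    2 ∣ m / m.gcd (t - 1) := by
  have hmpos := h.mpos
  obtain ⟨q, hq⟩ := Nat.gcd_dvd_left m (t - 1)
  have hg0 : 0 < m.gcd (t - 1) := Nat.gcd_pos_of_pos_left _ hmpos
  rw [Nat.div_eq_of_eq_mul_right hg0 hq]
  have h2g : ¬ 4 ∣ m.gcd (t - 1) := by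
    intro h0
    have := h0.trans (Nat.gcd_dvd_right m (t - 1))
    omega
  by_contra hodd
  have hc : Nat.Coprime 2 q := Nat.coprime_two_left.2 (Nat.odd_iff.2 (by omega))
  rw [hq] at hm
  exact h2g ((hc.pow_left 2).dvd_of_dvd_mul_right hm)

/-- When `t ^ (n / 2)` is nontrivial on the odd part, the powers of `t` fixing the odd part
fix everything. -/
theorem pow_modEq_of_modEq (h : MetaPres x b m n k t) (hn : Even n) (ht : t % 4 = 1)
    (h2 : ordProj[2] m ∣ 2 * (t - 1))
    (hu : ¬ t ^ (n / 2) ≡ 1 [MOD ordCompl[2] m]) (i : ℕ) (hi : t ^ i ≡ 1 [MOD ordCompl[2] m]) :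
    t ^ i ≡ 1 [MOD ordProj[2] m] := by
  have htp := h.tpos
  have key : ∀ (N i : ℕ), t ^ i ≡ 1 [MOD N] ↔ orderOf (t : ZMod N) ∣ i := by
    intro N i
    rw [orderOf_dvd_iff_pow_eq_one, ← ZMod.natCast_eq_natCast_iff]
    simp
  have hn' : t ^ n ≡ 1 [MOD ordCompl[2] m] := h.t_pow_n.of_dvd (Nat.ordCompl_dvd m 2)
  rcases Nat.even_or_odd i with ⟨l, rfl⟩ | hodd
  · have h3 : t ^ 2 ≡ 1 [MOD ordProj[2] m] := by
      refine ((Nat.modEq_iff_dvd' (Nat.one_le_pow _ _ htp)).2 ?_).symm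
      have : t ^ 2 - 1 = (t + 1) * (t - 1) := by
        simpa using Nat.sq_sub_sq t 1
      rw [this]
      exact h2.trans (Nat.mul_dvd_mul_right (by omega) _)
    rw [← two_mul, pow_mul]
    simpa using h3.pow l
  · exfalso
    apply hu
    rw [key] at hi hn' ⊢
    obtain ⟨N, rfl⟩ := hn
    have h3 : Nat.Coprime (orderOf (t : ZMod (ordCompl[2] m))) 2 :=
      (Nat.coprime_two_right.2 hodd).coprime_dvd_left hi
    rw [← two_mul] at hn' ⊢
    rw [Nat.mul_div_cancel_left _ two_pos]
    exact h3.dvd_of_dvd_mul_left hn'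

theorem exists_odd_mul_orderOf (h : MetaPres x b m n k t)
    (hu : ¬ t ^ (n / 2) ≡ 1 [MOD ordCompl[2] m]) :
    ∃ q, Odd q ∧ n = orderOf (t : ZMod m) * q := by
  have hd : orderOf (t : ZMod m) ∣ n := by
    rw [orderOf_dvd_iff_pow_eq_one]
    have := (ZMod.natCast_eq_natCast_iff _ _ _).2 h.t_pow_n
    simpa using this
  obtain ⟨q, hq⟩ := hd
  refine ⟨q, ?_, hq⟩
  by_contra hqe
  obtain ⟨p, hp⟩ := Nat.not_odd_iff_even.1 hqe
  apply hu
  have h1 : orderOf (t : ZMod m) ∣ n / 2 := ⟨p, by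
    rw [hq, hp, ← two_mul, mul_left_comm, Nat.mul_div_cancel_left _ two_pos]⟩
  have h2 : t ^ (n / 2) ≡ 1 [MOD m] := by
    rw [← ZMod.natCast_eq_natCast_iff]
    simpa using orderOf_dvd_iff_pow_eq_one.1 h1
  exact h2.of_dvd (Nat.ordCompl_dvd m 2)

end MetaPres

theorem dvd_ordCompl_two {a N : ℕ} (ha : Odd a) (hd : a ∣ N) : a ∣ ordCompl[2] N := by
  rw [← Nat.ordProj_mul_ordCompl_eq_self N 2] at hd
  exact ((Nat.coprime_two_right.2 ha).pow_right _).dvd_of_dvd_mul_left hd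

theorem IsIrrep.comp_algEquiv {A B V : Type*} [Ring A] [Ring B] [Algebra ℚ A] [Algebra ℚ B]
    [AddCommGroup V] [Module ℂ V] {φ : A →+* Module.End ℂ V} (hφ : IsIrrep φ) (e : B ≃ₐ[ℚ] A) :
    IsIrrep (φ.comp (e : B →+* A)) := fun W hW =>
  hφ W fun a w hw => by simpa using hW (e.symm a) w hw

theorem pow_eq_one_of_apply {V : Type*} [AddCommGroup V] [Module ℂ V] (ρ : G →* Module.End ℂ V)
    {y : G} {v : V} {d : ℂ} (hv : v ≠ 0) (hd : ρ y v = d • v) {N : ℕ} (hy : y ^ N = 1) :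
    d ^ N = 1 := by
  have hp : ∀ l : ℕ, ρ (y ^ l) v = d ^ l • v := by
    intro l
    induction l with
    | zero => simp
    | succ l ih => rw [pow_succ, map_mul, Module.End.mul_apply, hd, map_smul, ih, smul_smul, pow_succ']
  have h1 := hp N
  rw [hy, map_one, Module.End.one_apply] at h1
  have h2 : (1 - d ^ N) • v = 0 := by rw [sub_smul, one_smul, ← h1, sub_self]
  exact (sub_eq_zero.1 ((smul_eq_zero.1 h2).resolve_right hv)).symm

namespace MetaPres

variable {H : Type*} [Group H] {x b : G} {m n k t : ℕ} {x' b' : H}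
  {m' n' k' t' : ℕ}

theorem orderOf_le_of_algEquiv [Finite G] (h : MetaPres x b m n k t) (h' : MetaPres x' b' m' n' k' t')
    (e : MonoidAlgebra ℚ G ≃ₐ[ℚ] MonoidAlgebra ℚ H) :
    orderOf (t : ZMod m) ≤ orderOf (t' : ZMod m') := by
  have hζ := Complex.isPrimitiveRoot_exp m h.mpos.ne'
  obtain ⟨V, _, _, _, _, ψ, v, hψ, hv, hxv⟩ := h.exists_irrep hζ
  exact (h.le_finrank _ hv hζ hxv).trans (h'.exists_vector (hψ.comp_algEquiv e.symm)).1

theorem pow_card_half_eq_one (h : MetaPres x b m n k t) (hk : Even k) {u : ℕ} (hu : m = 2 * u) :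
    b ^ (n * u) = 1 := by
  obtain ⟨l, rfl⟩ := hk
  rw [pow_mul, h.pow, ← pow_mul, ← orderOf_dvd_iff_pow_eq_one, h.ord, hu]
  exact ⟨l, by ring⟩

theorem card_commutator_eq_of_algEquiv [Finite G] [Finite H] (e : MonoidAlgebra ℚ G ≃ₐ[ℚ] MonoidAlgebra ℚ H) :
    Nat.card (commutator G) = Nat.card (commutator H) := by
  have h1 := card_commutator_mul (G := G)
  have h2 := card_commutator_mul (G := H)
  rw [← Nat.card_congr (monoidHomCongr e ℂ), ← card_eq_of_algEquiv e, ← h1] at h2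
  have : 0 < Nat.card (G →* ℂ) := by
    refine Nat.pos_of_mul_pos_left (a := Nat.card (commutator G)) ?_
    rw [h1]
    exact Nat.card_pos
  exact (Nat.eq_of_mul_eq_mul_right this h2).symm

theorem four_le_card_hom [Finite G] (h : MetaPres x b m n k t) (hm : 4 ∣ m) (ht : t % 4 = 3) :
    4 ≤ Nat.card (G →* ℚ) := by
  obtain ⟨hk, hn⟩ := h.even_of_mod_four hm ht
  have hζ : IsPrimitiveRoot (-1 : ℚ) 2 := IsPrimitiveRoot.neg_one 0 (by norm_num)
  refine h.sq_le_card_hom (r := 2) (by omega) hn.two_dvd hk.two_dvd ?_ hζ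
  rw [Nat.ModEq]
  omega

/-- The constraints which one-dimensional characters put on an isomorphism of rational group
algebras between presentations with different values of `ε`. -/
theorem constraints_of_algEquiv [Finite G] [Finite H] (h : MetaPres x b m n k t) (h' : MetaPres x' b' m' n' k' t')
    (e : MonoidAlgebra ℚ G ≃ₐ[ℚ] MonoidAlgebra ℚ H) (hε : ¬ (4 ∣ m ∧ t % 4 = 3))
    (hm' : 4 ∣ m') (ht' : t' % 4 = 3) :
    4 ∣ m ∧ t % 4 = 1 ∧ Even k ∧ Even n ∧ ¬ (4 ∣ k ∧ 4 ∣ n) ∧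
      m / m.gcd (t - 1) = m' / m'.gcd (t' - 1) := by
  have hc : m / m.gcd (t - 1) = m' / m'.gcd (t' - 1) := by
    rw [← h.card_commutator, ← h'.card_commutator, card_commutator_eq_of_algEquiv e]
  obtain ⟨hk, hn⟩ := h.even_of_four_le_card_hom <| by
    rw [Nat.card_congr (monoidHomCongr e ℚ)]
    exact h'.four_le_card_hom hm' ht'
  have h2 : 2 ∣ m / m.gcd (t - 1) := hc ▸ h'.two_dvd_of_mod_four hm' ht'
  obtain ⟨q, hq⟩ := Nat.gcd_dvd_left m (t - 1)
  have hg0 : 0 < m.gcd (t - 1) := Nat.gcd_pos_of_pos_left _ h.mpos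
  rw [Nat.div_eq_of_eq_mul_right hg0 hq] at h2
  have h2m : 2 ∣ m := by
    rw [hq]
    exact h2.mul_left _
  have ht := h.t_odd h2m
  have h4m : 4 ∣ m := by
    rw [hq]
    exact mul_dvd_mul (Nat.dvd_gcd h2m (by omega)) h2
  have ht1 : t % 4 = 1 := by
    have : t % 4 ≠ 3 := fun h3 => hε ⟨h4m, h3⟩
    omega
  refine ⟨h4m, ht1, hk, hn, fun ⟨hk4, hn4⟩ => ?_, hc⟩
  have hI : IsPrimitiveRoot Complex.I 4 := Complex.isPrimitiveRoot_I
  set K := IntermediateField.adjoin ℚ {Complex.I} with hKdef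
  let ζ : K := ⟨Complex.I, IntermediateField.mem_adjoin_simple_self ℚ _⟩
  have hζ : IsPrimitiveRoot ζ 4 :=
    IsPrimitiveRoot.of_map_of_injective (f := algebraMap K ℂ) hI (algebraMap K ℂ).injective
  have hle := h'.card_hom_le ht' hζ fun u r hr hur => by
    have h1 : (u : ℂ) ^ r = 1 := by
      rw [← SubmonoidClass.coe_pow, hur]
      rfl
    have := pow_eq_one_of_mem_adjoin (by norm_num) (by decide) hI u.2 hr h1
    exact Subtype.ext this
  have hge := h.sq_le_card_hom h4m hn4 hk4 ht1 hζ
  rw [Nat.card_congr (monoidHomCongr e K)] at hge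
  omega

/-- The character field of an irreducible representation of `G` faithful on `⟨x⟩` contains a root of
unity whose order is a power of `2` too large for a representation of `H` of the same degree. -/
theorem false_of_algEquiv [Finite G] [Finite H] (h : MetaPres x b m n k t) (h' : MetaPres x' b' m' n' k' t')
    (e : MonoidAlgebra ℚ G ≃ₐ[ℚ] MonoidAlgebra ℚ H) (hε : ¬ (4 ∣ m ∧ t % 4 = 3))
    (hm' : 4 ∣ m') (ht' : t' % 4 = 3) (hmin : ∀ f : MetacyclicFact G, m ≤ Nat.card f.A) :
    False := by
  obtain ⟨h4m, ht, hk, hn, hkn, hcomm⟩ := h.constraints_of_algEquiv h' e hε hm' ht'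
  have hu : ¬ t ^ (n / 2) ≡ 1 [MOD ordCompl[2] m] := fun hu => by
    obtain ⟨f, hf⟩ := h.exists_fact_card_lt h4m ht hk hn hkn hu
    exact (hmin f).not_gt hf
  have h2 := h.two_pow_dvd ht hk hn hkn
  obtain ⟨hf3, h4c⟩ := h.factorization_two_eq h4m ht h2
    (hcomm ▸ h'.two_dvd_of_mod_four hm' ht')
  have h8 := h'.not_eight_dvd ht' (hcomm ▸ h4c)
  have hst := h.pow_modEq_of_modEq hn ht h2 hu
  obtain ⟨q, hq, hnq⟩ := h.exists_odd_mul_orderOf hu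
  have hmo : ordProj[2] m * ordCompl[2] m = m := Nat.ordProj_mul_ordCompl_eq_self m 2
  have hoodd : Odd (ordCompl[2] m) := by
    rw [← Nat.not_even_iff_odd, even_iff_two_dvd]
    exact Nat.not_dvd_ordCompl Nat.prime_two h.mpos.ne'
  have hopos : 0 < ordCompl[2] m := hoodd.pos
  generalize hodef : ordCompl[2] m = o at *
  obtain ⟨g, hg⟩ : ∃ g, m.factorization 2 = g + 1 := ⟨m.factorization 2 - 1, by omega⟩
  rw [hg] at hmo h2 hst
  have hj : orderOf (t' : ZMod m') = orderOf (t : ZMod m) :=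
    (h'.orderOf_le_of_algEquiv h e.symm).antisymm (h.orderOf_le_of_algEquiv h' e)
  have hcard : n * m = n' * m' := by rw [← h.card, ← h'.card, card_eq_of_algEquiv e]
  have hnm : n * m = orderOf (t : ZMod m) * q * (2 ^ (g + 1) * o) := by rw [hmo, ← hnq]
  obtain ⟨C, hC⟩ : ∃ C, ordCompl[2] (n * m) = C := ⟨_, rfl⟩
  have hnm0 : n * m ≠ 0 := (Nat.mul_pos h.npos h.mpos).ne'
  have hCodd : Odd C := by
    rw [← hC, ← Nat.not_even_iff_odd, even_iff_two_dvd]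
    exact Nat.not_dvd_ordCompl Nat.prime_two hnm0
  have hCd : ∀ a, Odd a → a ∣ n * m → a ∣ C := fun a ha had => hC ▸ dvd_ordCompl_two ha had
  have hg2 : 4 ∣ 2 ^ g := pow_dvd_pow 2 (show 2 ≤ g by omega)
  have hN0 : 0 < 2 ^ g * C := Nat.mul_pos (by positivity) hCodd.pos
  have hNev : Even (2 ^ g * C) :=
    ((even_iff_two_dvd.2 ((by norm_num : 2 ∣ 4).trans hg2)).mul_right C)
  have hζ0 := Complex.isPrimitiveRoot_exp _ hN0.ne'
  have hζ := Complex.isPrimitiveRoot_exp m h.mpos.ne'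
  have hF : ∀ {u : ℂ} {r : ℕ}, r ∣ 2 ^ g * C → u ^ r = 1 → u ∈ _ := fun {u r} hr hur =>
    mem_adjoin_of_pow_eq_one hN0 hζ0 (u := u) (orderOf_dvd_iff_pow_eq_one.1
      ((orderOf_dvd_of_pow_eq_one hur).trans hr))
  set F := IntermediateField.adjoin ℚ {Complex.exp (2 * Real.pi * Complex.I / ↑(2 ^ g * C))}
  set ζ := Complex.exp (2 * Real.pi * Complex.I / m)
  obtain ⟨V, _, _, _, _, ψ, v, hψ, hv, hxv⟩ := h.exists_irrep hζ
  have hφ := hψ.comp_algEquiv e.symm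
  obtain ⟨hle, w, c, d, hw, hcw, hdw, hmem⟩ := h'.exists_vector hφ
  have hrank := hle.antisymm (hj.trans_le (h.le_finrank _ hv hζ hxv))
  have hcF : c ∈ F := by
    have h1 : c ^ m' = 1 := pow_eq_one_of_apply _ hw hcw (h'.ord ▸ pow_orderOf_eq_one x')
    obtain ⟨a, ha⟩ := hm'
    have haodd : Odd a := by
      rw [← Nat.not_even_iff_odd]
      rintro ⟨a', rfl⟩
      omega
    refine hF ?_ h1
    rw [ha]
    exact mul_dvd_mul hg2 (hCd a haodd ⟨n' * 4, by rw [hcard, ha]; ring⟩)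
  have hdF : d ∈ F := by
    have hm2 : m' = 2 * (m' / 2) := by omega
    have h1 := h'.pow_card_half_eq_one (h'.even_of_mod_four hm' ht').1 hm2
    have h3 : n' * (m' / 2) = orderOf (t' : ZMod m') * (2 ^ g * (q * o)) := by
      refine Nat.eq_of_mul_eq_mul_left two_pos ?_
      calc 2 * (n' * (m' / 2)) = n' * m' := by rw [mul_left_comm, ← hm2]
        _ = 2 * (orderOf (t' : ZMod m') * (2 ^ g * (q * o))) := by
          rw [← hcard, hj, hnm, pow_succ]
          ring
    refine hF (mul_dvd_mul_left (2 ^ g) (hCd (q * o) (hq.mul hoodd) ?_))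
      (pow_eq_one_of_apply _ hw hdw (by rw [← pow_mul, ← h3, h1]))
    exact ⟨orderOf (t : ZMod m) * 2 ^ (g + 1), by rw [hnm]; ring⟩
  have hsum : ∀ s, ∑ i ∈ Finset.range n, ζ ^ (s * t ^ i) ∈ F := by
    intro s
    have hz : (ψ.comp (e.symm : MonoidAlgebra ℚ H →+* MonoidAlgebra ℚ G))
        (e (∑ i ∈ Finset.range n, MonoidAlgebra.of ℚ G (x ^ (s * t ^ i)))) =
        ∑ i ∈ Finset.range n, toMonoidEnd ψ (x ^ (s * t ^ i)) := by
      simp [toMonoidEnd]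
    refine hmem hrank F hcF hdF _ _ ((LinearMap.congr_fun hz w).trans ?_)
    exact h.isScalar_of_commute hψ (commute_sum_x _ s) (h.commute_sum_b _ s) hv
      (sum_apply _ hxv s) w
  have hζ' : IsPrimitiveRoot ζ (2 ^ (g + 1) * o) := hmo.symm ▸ hζ
  have hηF : ζ ^ 2 ^ (g + 1) ∈ F := by
    refine hF (r := o) ((hCd o hoodd ?_).mul_left _) ?_
    · exact ((Dvd.intro_left _ hmo).mul_left n)
    · rw [← pow_mul, hmo]
      exact hζ.pow_eq_one
  have hmemF := pow_mem_of_sum_mem hopos h.npos hζ' h.tpos h2 hst hηF hsum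
  have hξ : IsPrimitiveRoot (ζ ^ o) (2 ^ (g + 1)) :=
    hζ.pow h.mpos (by rw [mul_comm, hmo])
  have hone := pow_eq_one_of_mem_adjoin hN0 hNev hζ0 hmemF (by positivity) hξ.pow_eq_one
  have hdvd := (hξ.pow_eq_one_iff_dvd _).1 hone
  have := ((Nat.coprime_two_left.2 hCodd).pow_left _).dvd_of_dvd_mul_right hdvd
  exact absurd ((Nat.pow_dvd_pow_iff_le_right (by norm_num)).1 this) (by omega)

end MetaPres

theorem IsMinimalFact.card_le {f : MetacyclicFact G} (hf : IsMinimalFact f)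
    (f' : MetacyclicFact G) : Nat.card f.A ≤ Nat.card f'.A :=
  (hf f').elim le_of_lt fun h => h.1.le

theorem epsOf_eq_neg_one_of_algEquiv {G H : Type*} [Group G] [Group H] [Finite G] [Finite H]
    {fG : MetacyclicFact G} (hfG : IsMinimalFact fG) {fH : MetacyclicFact H}
    (e : MonoidAlgebra ℚ G ≃ₐ[ℚ] MonoidAlgebra ℚ H) (hH : epsOf fH = -1) : epsOf fG = -1 := by
  obtain ⟨x, b, m, n, k, t, hA, h⟩ := fG.exists_metaPres
  obtain ⟨x', b', m', n', k', t', hA', h'⟩ := fH.exists_metaPres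
  have hmin : ∀ f : MetacyclicFact G, m ≤ Nat.card f.A := fun f => by
    have := hfG.card_le f
    rwa [hA, Nat.card_zpowers, h.ord] at this
  rw [epsOf, hA', h'.eps_iff] at hH
  rw [epsOf, hA, h.eps_iff]
  by_contra hG
  exact h.false_of_algEquiv h' e hG hH.1 hH.2 hmin

theorem epsOf_eq_one_or_neg_one (f : MetacyclicFact G) : epsOf f = 1 ∨ epsOf f = -1 := by
  unfold epsOf epsOfA
  split_ifs
  · exact Or.inl rfl
  · exact Or.inr rfl

/-- If `ℚG ≅ ℚH` for finite metacyclic `G, H`, then `ε^G = ε^H`. -/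
theorem eps_eq_of_qalgebra_iso {G H : Type*} [Group G] [Group H] [Finite G] [Finite H]
    (fG : MetacyclicFact G) (hfG : IsMinimalFact fG)
    (fH : MetacyclicFact H) (hfH : IsMinimalFact fH)
    (h : Nonempty (MonoidAlgebra ℚ G ≃ₐ[ℚ] MonoidAlgebra ℚ H)) :
    epsOf fG = epsOf fH := by
  obtain ⟨e⟩ := h
  rcases epsOf_eq_one_or_neg_one fG with hG | hG
  · rcases epsOf_eq_one_or_neg_one fH with hH | hH
    · rw [hG, hH]
    · rw [epsOf_eq_neg_one_of_algEquiv hfG e hH, hH]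
  · rw [hG, epsOf_eq_neg_one_of_algEquiv hfH e.symm hG]

end ArXiv230800432
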